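/- arXiv:2011.09227 — 2 statements merged into one kernel-verified Lean document; each statement's English description precedes it below -/
import Mathlib

section
/- Let n ≥ 6, let i ∈ ℤ/n, and set I = {i, i+2, i+4}, X = {i+1, i+3, i+5}, Y = {i+2, i+4, i+6}, A = {i+1, i+2, i+4}, B = {i, i+3, i+5} (all computed modulo n). Suppose 0 → L_I → M → N_0 → 0 is an almost split sequence in CM(B_{3,n}) where N_0 admits the filtration L_X | L_Y, and suppose M is isomorphic to L_A ⊕ N for some module N in CM(B_{3,n}). Then N is indecomposable if and only if n ≥ 7, and in that case N admits the filtration L_B | L_Y. -/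
open scoped Classical

noncomputable section

namespace GCC

/-- The base ring `R = ℂ⟦t⟧` of formal power series. -/
abbrev Rser : Type := PowerSeries ℂ

/-- The power series variable `t`. -/
noncomputable def tser : Rser := PowerSeries.X

/-- The cyclic product `X i * X (i-1) * ⋯ * X (i-(n-1))`, i.e.
`X_{i+n} · X_{i+n-1} · ⋯ · X_{i+1}` with indices read modulo `n`. -/
def cycProd {n s : ℕ} (X : ZMod n → Matrix (Fin s) (Fin s) Rser) (i : ZMod n) :
    Matrix (Fin s) (Fin s) Rser :=
  ((List.range n).map fun j => X (i - (j : ZMod n))).prod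

/-- A (maximal) Cohen–Macaulay `B_{k,n}`-module of rank `s`: a family of `s × s`
matrices `X i`, `Y i` over `ℂ⟦t⟧`, indexed by `ℤ/n`, subject to the relations
`X i * Y i = t·Id`, `Y i * X i = t·Id`, and the cyclic relation
`X_{i+n} ⋯ X_{i+1} = t^(n-k)·Id`. -/
structure CMMod (k n s : ℕ) : Type where
  X : ZMod n → Matrix (Fin s) (Fin s) Rser
  Y : ZMod n → Matrix (Fin s) (Fin s) Rser
  hXY : ∀ i, X i * Y i = tser • (1 : Matrix (Fin s) (Fin s) Rser)
  hYX : ∀ i, Y i * X i = tser • (1 : Matrix (Fin s) (Fin s) Rser)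
  hcyc : ∀ i, cycProd X i = (tser ^ (n - k)) • (1 : Matrix (Fin s) (Fin s) Rser)

/-- A morphism of Cohen–Macaulay `B_{k,n}`-modules: a family of matrices
`F i` with `F i * X i = X' i * F (i-1)` and `F (i-1) * Y i = Y' i * F i`. -/
structure CMHom {k n s s' : ℕ} (M : CMMod k n s) (M' : CMMod k n s') : Type where
  F : ZMod n → Matrix (Fin s') (Fin s) Rser
  hX : ∀ i, F i * M.X i = M'.X i * F (i - 1)
  hY : ∀ i, F (i - 1) * M.Y i = M'.Y i * F i

/-- `M` is indecomposable: its only idempotent endomorphisms are `0` and the identity. -/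
def Indecomposable {k n s : ℕ} (M : CMMod k n s) : Prop :=
  ∀ f : CMHom M M, (∀ i, f.F i * f.F i = f.F i) → (∀ i, f.F i = 0) ∨ (∀ i, f.F i = 1)

/-- A short exact sequence `0 → A → E → B → 0` in `CM(B_{k,n})`: a pair of
morphisms that is exact at each index `i` as a sequence of `R`-modules. -/
structure CMses {k n sA sE sB : ℕ} (A : CMMod k n sA) (E : CMMod k n sE)
    (B : CMMod k n sB) : Type where
  emb : CMHom A E
  quo : CMHom E B
  inj : ∀ i, Function.Injective ((emb.F i).mulVecLin)
  exactness : ∀ i, LinearMap.range ((emb.F i).mulVecLin) = LinearMap.ker ((quo.F i).mulVecLin)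
  surj : ∀ i, Function.Surjective ((quo.F i).mulVecLin)

/-- A short exact sequence splits if some morphism `ρ : E → A` satisfies `ρ ∘ ι = id`. -/
def CMses.Splits {k n sA sE sB : ℕ} {A : CMMod k n sA} {E : CMMod k n sE} {B : CMMod k n sB}
    (S : CMses A E B) : Prop :=
  ∃ ρ : CMHom E A, ∀ i, ρ.F i * S.emb.F i = 1

/-- `M` is rigid: every short exact sequence `0 → M → E → M → 0` splits. -/
def Rigid {k n s : ℕ} (M : CMMod k n s) : Prop :=
  ∀ (sE : ℕ) (E : CMMod k n sE) (S : CMses M E M), S.Splits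

/-- `N` is the rank-1 module `L_I`: `X i = 1`, `Y i = t` for `i ∈ I`, and
`X i = t`, `Y i = 1` for `i ∉ I`. -/
def IsRankOne {k n : ℕ} (I : Finset (ZMod n)) (N : CMMod k n 1) : Prop :=
  (∀ i, N.X i = if i ∈ I then 1 else tser • 1) ∧
  (∀ i, N.Y i = if i ∈ I then tser • 1 else 1)

/-- `M` admits the filtration `L_{I₁} | L_{I₂} | ⋯ | L_{Iₘ}`: there are modules
`M = N₁, N₂, …, Nₘ = L_{Iₘ}` and short exact sequences
`0 → N_{j+1} → N_j → L_{I_j} → 0`. -/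
inductive HasFiltration {k n : ℕ} : {s : ℕ} → CMMod k n s → List (Finset (ZMod n)) → Prop
  | base {I : Finset (ZMod n)} {N : CMMod k n 1} : IsRankOne I N → HasFiltration N [I]
  | step {s s' : ℕ} {N : CMMod k n s} {M : CMMod k n s'} {Q : CMMod k n 1}
      {I : Finset (ZMod n)} {rest : List (Finset (ZMod n))} :
      IsRankOne I Q → HasFiltration N rest → Nonempty (CMses N M Q) →
      HasFiltration M (I :: rest)


/-- `f : X → B` is a split epimorphism: `f ∘ g = id_B` for some `g : B → X`. -/
def IsSplitEpi {k n sX sB : ℕ} {Xm : CMMod k n sX} {B : CMMod k n sB} (f : CMHom Xm B) : Prop :=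
  ∃ g : CMHom B Xm, ∀ i, f.F i * g.F i = 1

/-- `S : 0 → A → E → B → 0` is an almost split (Auslander–Reiten) sequence:
it does not split, `A` and `B` are indecomposable, and every morphism to `B`
which is not a split epimorphism factors through `E`. -/
def AlmostSplit {k n sA sE sB : ℕ} {A : CMMod k n sA} {E : CMMod k n sE} {B : CMMod k n sB}
    (S : CMses A E B) : Prop :=
  ¬ S.Splits ∧ Indecomposable A ∧ Indecomposable B ∧
  ∀ (sX : ℕ) (Xm : CMMod k n sX) (f : CMHom Xm B), ¬ IsSplitEpi f →
    ∃ g : CMHom Xm E, ∀ i, S.quo.F i * g.F i = f.F i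

/-- `E` is isomorphic to the direct sum `M1 ⊕ M2`: there are morphisms
`f : M1 → E`, `g : M2 → E` whose combined map `(v, w) ↦ f v + g w` is
bijective at every index. -/
def IsDirectSumOf {k n sE s1 s2 : ℕ} (E : CMMod k n sE) (M1 : CMMod k n s1)
    (M2 : CMMod k n s2) : Prop :=
  ∃ (f : CMHom M1 E) (g : CMHom M2 E), ∀ i,
    Function.Bijective fun p : (Fin s1 → Rser) × (Fin s2 → Rser) =>
      (f.F i).mulVec p.1 + (g.F i).mulVec p.2

section Auxiliary

variable {k n s s' : ℕ}

theorem tser_smul_cancel {a b : ℕ} {Z Z' : Matrix (Fin a) (Fin b) Rser}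
    (h : tser • Z = tser • Z') : Z = Z' := by
  ext1 p q
  have := congrFun (congrFun h p) q
  simp only [Matrix.smul_apply, smul_eq_mul] at this
  exact mul_left_cancel₀ PowerSeries.X_ne_zero this

theorem tser_dvd_or_isUnit (c : Rser) : tser ∣ c ∨ IsUnit c := by
  by_cases h : PowerSeries.constantCoeff c = 0
  · exact Or.inl (PowerSeries.X_dvd_iff.2 h)
  · exact Or.inr (PowerSeries.isUnit_iff_constantCoeff.2 (isUnit_iff_ne_zero.2 h))

theorem tser_smul_ne_one {a : ℕ} (p : Fin a) (Z : Matrix (Fin a) (Fin a) Rser) :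
    tser • Z ≠ 1 := by
  intro h
  have := congrFun (congrFun h p) p
  simp only [Matrix.smul_apply, smul_eq_mul, Matrix.one_apply_eq] at this
  have h2 := congrArg PowerSeries.constantCoeff this
  simp [tser] at h2

theorem matrix_one_dichotomy (c : Matrix (Fin 1) (Fin 1) Rser) :
    (∃ c' : Matrix (Fin 1) (Fin 1) Rser, c = tser • c') ∨
      ∃ c' : Matrix (Fin 1) (Fin 1) Rser, c * c' = 1 := by
  rcases tser_dvd_or_isUnit (c 0 0) with ⟨d, hd⟩ | hu
  · refine Or.inl ⟨Matrix.of fun _ _ => d, ?_⟩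
    ext1 p q
    fin_cases p; fin_cases q
    simpa using hd
  · obtain ⟨d, hd⟩ := hu.exists_right_inv
    refine Or.inr ⟨Matrix.of fun _ _ => d, ?_⟩
    ext1 p q
    fin_cases p; fin_cases q
    simpa [Matrix.mul_apply] using hd

namespace CMMod

theorem X_mul_Y_mul (M : CMMod k n s) (j : ZMod n) {b : ℕ} (Z : Matrix (Fin s) (Fin b) Rser) :
    M.X j * (M.Y j * Z) = tser • Z := by
  rw [← Matrix.mul_assoc, M.hXY, Matrix.smul_mul, Matrix.one_mul]

theorem Y_mul_X_mul (M : CMMod k n s) (j : ZMod n) {b : ℕ} (Z : Matrix (Fin s) (Fin b) Rser) :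
    M.Y j * (M.X j * Z) = tser • Z := by
  rw [← Matrix.mul_assoc, M.hYX, Matrix.smul_mul, Matrix.one_mul]

theorem X_cancel (M : CMMod k n s) (j : ZMod n) {b : ℕ} {Z Z' : Matrix (Fin s) (Fin b) Rser}
    (h : M.X j * Z = M.X j * Z') : Z = Z' :=
  tser_smul_cancel (by rw [← M.Y_mul_X_mul j, h, M.Y_mul_X_mul])

theorem Y_cancel (M : CMMod k n s) (j : ZMod n) {b : ℕ} {Z Z' : Matrix (Fin s) (Fin b) Rser}
    (h : M.Y j * Z = M.Y j * Z') : Z = Z' :=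
  tser_smul_cancel (by rw [← M.X_mul_Y_mul j, h, M.X_mul_Y_mul])

theorem cancel_X (M : CMMod k n s) (j : ZMod n) {b : ℕ} {Z Z' : Matrix (Fin b) (Fin s) Rser}
    (h : Z * M.X j = Z' * M.X j) : Z = Z' := by
  have := congrArg (· * M.Y j) h
  simp only [Matrix.mul_assoc, M.hXY, Matrix.mul_smul, Matrix.mul_one] at this
  exact tser_smul_cancel this

theorem Y_eq_of_X_eq_one {M : CMMod k n s} {j : ZMod n} (h : M.X j = 1) :
    M.Y j = tser • 1 := by
  have := M.hXY j
  rwa [h, Matrix.one_mul] at this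

theorem Y_eq_of_X_eq_tser {M : CMMod k n s} {j : ZMod n} (h : M.X j = tser • 1) :
    M.Y j = 1 := by
  have := M.hXY j
  rw [h, Matrix.smul_mul, Matrix.one_mul] at this
  exact tser_smul_cancel this

end CMMod

/-- The relations with `Y` imply the relations with `X`. -/
def CMHom.ofY {M : CMMod k n s} {M' : CMMod k n s'} (F : ZMod n → Matrix (Fin s') (Fin s) Rser)
    (hY : ∀ i, F (i - 1) * M.Y i = M'.Y i * F i) : CMHom M M' where
  F := F
  hX i := by
    apply M'.Y_cancel i
    rw [← Matrix.mul_assoc, ← hY, Matrix.mul_assoc, M.hYX, M'.Y_mul_X_mul, Matrix.mul_smul,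
      Matrix.mul_one]
  hY := hY

/-- The relations with `X` imply the relations with `Y`. -/
def CMHom.ofX {M : CMMod k n s} {M' : CMMod k n s'} (F : ZMod n → Matrix (Fin s') (Fin s) Rser)
    (hX : ∀ i, F i * M.X i = M'.X i * F (i - 1)) : CMHom M M' where
  F := F
  hX := hX
  hY i := by
    apply M'.X_cancel i
    rw [← Matrix.mul_assoc, ← hX, Matrix.mul_assoc, M.hXY, M'.X_mul_Y_mul, Matrix.mul_smul,
      Matrix.mul_one]

@[simp]
theorem CMHom.ofY_F {M : CMMod k n s} {M' : CMMod k n s'}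
    (F : ZMod n → Matrix (Fin s') (Fin s) Rser)
    (hY : ∀ i, F (i - 1) * M.Y i = M'.Y i * F i) : (CMHom.ofY F hY).F = F := rfl

/-- Composition of morphisms. -/
def CMHom.comp {s'' : ℕ} {M : CMMod k n s} {M' : CMMod k n s'} {M'' : CMMod k n s''}
    (g : CMHom M' M'') (f : CMHom M M') : CMHom M M'' :=
  CMHom.ofY (fun j => g.F j * f.F j) fun j => by
    rw [Matrix.mul_assoc, f.hY, ← Matrix.mul_assoc, g.hY, Matrix.mul_assoc]

theorem zmod_pred_induction {P : ZMod n → Prop} [NeZero n] (i : ZMod n) (h0 : P i)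
    (hs : ∀ j, P j → P (j - 1)) (j : ZMod n) : P j := by
  have key : ∀ m : ℕ, P (i - m) := by
    intro m
    induction m with
    | zero => simpa using h0
    | succ m ih =>
      have := hs _ ih
      rwa [sub_sub, ← Nat.cast_succ] at this
  have := key (i - j).val
  rwa [ZMod.natCast_zmod_val, sub_sub_cancel] at this

theorem mul_cycProd {X : ZMod n → Matrix (Fin s) (Fin s) Rser}
    {X' : ZMod n → Matrix (Fin s') (Fin s') Rser} {F : ZMod n → Matrix (Fin s') (Fin s) Rser}
    (h : ∀ i, F i * X i = X' i * F (i - 1)) (i : ZMod n) :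
    F i * cycProd X i = cycProd X' i * F i := by
  have key : ∀ m : ℕ, F i * ((List.range m).map fun j : ℕ => X (i - (j : ZMod n))).prod =
      ((List.range m).map fun j : ℕ => X' (i - (j : ZMod n))).prod * F (i - m) := by
    intro m
    induction m with
    | zero => simp
    | succ m ih =>
      rw [List.range_succ, List.map_append, List.map_append, List.prod_append, List.prod_append,
        ← Matrix.mul_assoc, ih]
      simp only [List.map_cons, List.map_nil, List.prod_cons, List.prod_nil, mul_one]
      rw [Matrix.mul_assoc, h, Matrix.mul_assoc, sub_sub, ← Nat.cast_succ]
  have hc : ∀ {r : ℕ} (X : ZMod n → Matrix (Fin r) (Fin r) Rser),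
      cycProd X i = ((List.range n).map fun j : ℕ => X (i - (j : ZMod n))).prod := by
    intro r X
    rw [List.map_eq_flatMap]
    simp [cycProd, List.map_flatMap]
  simpa [hc] using key n

/-- If `X (i+1) * X i = t W`, replace the vertex `i` of `M` by a copy of the vertex `i + 1`. -/
def modify (M : CMMod k n s) (i : ZMod n) (W : Matrix (Fin s) (Fin s) Rser)
    (hW : M.X (i + 1) * M.X i = tser • W) (h1 : (1 : ZMod n) ≠ 0) : CMMod k n s where
  X j := if j = i then W else if j = i + 1 then tser • 1 else M.X j
  Y j := if j = i then M.Y i * M.Y (i + 1) else if j = i + 1 then 1 else M.Y j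
  hXY j := by
    split_ifs with h h'
    · apply tser_smul_cancel
      rw [← Matrix.smul_mul, ← hW, Matrix.mul_assoc, M.X_mul_Y_mul, Matrix.mul_smul, M.hXY]
    · simp
    · exact M.hXY j
  hYX j := by
    split_ifs with h h'
    · apply tser_smul_cancel
      rw [← Matrix.mul_smul, ← hW, Matrix.mul_assoc, M.Y_mul_X_mul, Matrix.mul_smul, M.hYX]
    · simp
    · exact M.hYX j
  hcyc j := by
    have hi : i - 1 ≠ i := by simpa using h1
    have key := mul_cycProd (X := fun j => if j = i then W else if j = i + 1 then tser • 1 else M.X j)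
      (X' := M.X) (F := fun j => if j = i then M.Y (i + 1) else 1) (by
        intro j
        by_cases h : j = i
        · subst h
          simp only [if_true, hi, if_false]
          apply tser_smul_cancel
          rw [← Matrix.mul_smul, ← hW, M.Y_mul_X_mul, Matrix.mul_one]
        · by_cases h' : j = i + 1
          · subst h'
            simp [h1, M.hXY]
          · have : j - 1 ≠ i := fun e => h' (by rw [← e]; ring)
            simp [h, h', this]) j
    rw [M.hcyc, Matrix.smul_mul, Matrix.one_mul] at key
    by_cases h : j = i
    · subst h
      simp only [if_true] at key
      apply M.Y_cancel (j + 1)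
      rw [key, Matrix.mul_smul, Matrix.mul_one]
    · simpa only [h, if_false, Matrix.one_mul] using key

section Modify

variable {M : CMMod k n s} {i : ZMod n} {W : Matrix (Fin s) (Fin s) Rser}
  {hW : M.X (i + 1) * M.X i = tser • W} {h1 : (1 : ZMod n) ≠ 0}

theorem modify_X_self : (modify M i W hW h1).X i = W := by simp [modify]

theorem modify_Y_self : (modify M i W hW h1).Y i = M.Y i * M.Y (i + 1) := by simp [modify]

theorem modify_X_succ : (modify M i W hW h1).X (i + 1) = tser • 1 := by simp [modify, h1]

theorem modify_Y_succ : (modify M i W hW h1).Y (i + 1) = 1 := by simp [modify, h1]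

theorem modify_X_of_ne {j : ZMod n} (h : j ≠ i) (h' : j ≠ i + 1) :
    (modify M i W hW h1).X j = M.X j := by simp [modify, h, h']

theorem modify_Y_of_ne {j : ZMod n} (h : j ≠ i) (h' : j ≠ i + 1) :
    (modify M i W hW h1).Y j = M.Y j := by simp [modify, h, h']

end Modify

/-- To prove `P j` for all `j`, it suffices to treat `i`, `i + 1` and the other `j`. -/
theorem forall_of_self_succ {P : ZMod n → Prop} (i : ZMod n) (h0 : P i) (h1 : P (i + 1))
    (h2 : ∀ j, j ≠ i → j - 1 ≠ i → P j) (j : ZMod n) : P j := by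
  by_cases h : j = i
  · exact h ▸ h0
  · by_cases h' : j - 1 = i
    · have : j = i + 1 := by rw [← h']; ring
      exact this ▸ h1
    · exact h2 j h h'

theorem ne_succ_of_pred_ne {i j : ZMod n} (h : j - 1 ≠ i) : j ≠ i + 1 := by
  rintro rfl
  exact h (by ring)

/-- The canonical morphism from the modification to the module. -/
def modifyHom (M : CMMod k n s) (i : ZMod n) (W : Matrix (Fin s) (Fin s) Rser)
    (hW : M.X (i + 1) * M.X i = tser • W) (h1 : (1 : ZMod n) ≠ 0) :
    CMHom (modify M i W hW h1) M :=
  CMHom.ofY (fun j => if j = i then M.Y (i + 1) else 1) (forall_of_self_succ i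
    (by simp [modify_Y_self, h1]) (by simp [modify_Y_succ, h1])
    (fun j h h' => by simp [modify_Y_of_ne h (ne_succ_of_pred_ne h'), h, h']))

theorem modifyHom_self {M : CMMod k n s} {i : ZMod n} {W : Matrix (Fin s) (Fin s) Rser}
    {hW : M.X (i + 1) * M.X i = tser • W} {h1 : (1 : ZMod n) ≠ 0} :
    (modifyHom M i W hW h1).F i = M.Y (i + 1) := by simp [modifyHom, CMHom.ofY]

theorem modifyHom_of_ne {M : CMMod k n s} {i j : ZMod n} {W : Matrix (Fin s) (Fin s) Rser}
    {hW : M.X (i + 1) * M.X i = tser • W} {h1 : (1 : ZMod n) ≠ 0} (h : j ≠ i) :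
    (modifyHom M i W hW h1).F j = 1 := by simp [modifyHom, CMHom.ofY, h]

/-- Modification is functorial. -/
def modifyMap {M : CMMod k n s} {M' : CMMod k n s'} (f : CMHom M M') (i : ZMod n)
    (W : Matrix (Fin s) (Fin s) Rser) (hW : M.X (i + 1) * M.X i = tser • W)
    (W' : Matrix (Fin s') (Fin s') Rser) (hW' : M'.X (i + 1) * M'.X i = tser • W')
    (h1 : (1 : ZMod n) ≠ 0) : CMHom (modify M i W hW h1) (modify M' i W' hW' h1) :=
  CMHom.ofY (fun j => if j = i then f.F (i + 1) else f.F j) (forall_of_self_succ i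
    (by
      have e1 := f.hY i
      have e2 := f.hY (i + 1)
      rw [add_sub_cancel_right] at e2
      have hi : i - 1 ≠ i := by simpa using h1
      simp only [modify_Y_self, if_true, hi, if_false]
      rw [← Matrix.mul_assoc, e1, Matrix.mul_assoc, e2, Matrix.mul_assoc])
    (by simp [modify_Y_succ, h1])
    (fun j h h' => by
      simp [modify_Y_of_ne h (ne_succ_of_pred_ne h'), h, h', f.hY]))

/-- Modification is exact. -/
def modifySes {sA sE sB : ℕ} {A : CMMod k n sA} {E : CMMod k n sE} {B : CMMod k n sB}
    (S : CMses A E B) (i : ZMod n)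
    (W₁ : Matrix (Fin sA) (Fin sA) Rser) (h₁ : A.X (i + 1) * A.X i = tser • W₁)
    (W₂ : Matrix (Fin sE) (Fin sE) Rser) (h₂ : E.X (i + 1) * E.X i = tser • W₂)
    (W₃ : Matrix (Fin sB) (Fin sB) Rser) (h₃ : B.X (i + 1) * B.X i = tser • W₃)
    (h1 : (1 : ZMod n) ≠ 0) :
    CMses (modify A i W₁ h₁ h1) (modify E i W₂ h₂ h1) (modify B i W₃ h₃ h1) where
  emb := modifyMap S.emb i W₁ h₁ W₂ h₂ h1
  quo := modifyMap S.quo i W₂ h₂ W₃ h₃ h1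
  inj j := by
    by_cases h : j = i
    · simpa only [modifyMap, CMHom.ofY, h, if_true] using S.inj (i + 1)
    · simpa only [modifyMap, CMHom.ofY, h, if_false] using S.inj j
  exactness j := by
    by_cases h : j = i
    · simpa only [modifyMap, CMHom.ofY, h, if_true] using S.exactness (i + 1)
    · simpa only [modifyMap, CMHom.ofY, h, if_false] using S.exactness j
  surj j := by
    by_cases h : j = i
    · simpa only [modifyMap, CMHom.ofY, h, if_true] using S.surj (i + 1)
    · simpa only [modifyMap, CMHom.ofY, h, if_false] using S.surj j

namespace CMses

variable {sA sE sB : ℕ} {A : CMMod k n sA} {E : CMMod k n sE} {B : CMMod k n sB}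

theorem emb_cancel (S : CMses A E B) (j : ZMod n) {b : ℕ} {Z Z' : Matrix (Fin sA) (Fin b) Rser}
    (h : S.emb.F j * Z = S.emb.F j * Z') : Z = Z' := by
  have key : ∀ q, Z.col q = Z'.col q := by
    intro q
    apply S.inj j
    ext1 p
    exact congrFun (congrFun h p) q
  ext1 p q
  exact congrFun (key q) p

theorem exists_emb_mul (S : CMses A E B) (j : ZMod n) {b : ℕ} {Z : Matrix (Fin sE) (Fin b) Rser}
    (h : S.quo.F j * Z = 0) : ∃ C : Matrix (Fin sA) (Fin b) Rser, Z = S.emb.F j * C := by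
  have key : ∀ q, ∃ v, (S.emb.F j).mulVec v = Z.col q := by
    intro q
    have : Z.col q ∈ LinearMap.range (S.emb.F j).mulVecLin := by
      rw [S.exactness, LinearMap.mem_ker, Matrix.mulVecLin_apply]
      ext1 p
      exact congrFun (congrFun h p) q
    exact this
  choose v hv using key
  refine ⟨Matrix.of fun p q => v q p, ?_⟩
  ext1 p q
  exact (congrFun (hv q) p).symm

theorem exists_quo_mul (S : CMses A E B) (j : ZMod n) {b : ℕ} (Z : Matrix (Fin sB) (Fin b) Rser) :
    ∃ C : Matrix (Fin sE) (Fin b) Rser, S.quo.F j * C = Z := by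
  choose v hv using fun q => S.surj j (Z.col q)
  refine ⟨Matrix.of fun p q => v q p, ?_⟩
  ext1 p q
  exact congrFun (hv q) p

theorem quo_mul_emb (S : CMses A E B) (j : ZMod n) : S.quo.F j * S.emb.F j = 0 := by
  ext1 p q
  have : (S.emb.F j).mulVecLin (Pi.single q 1) ∈ LinearMap.ker (S.quo.F j).mulVecLin := by
    rw [← S.exactness]
    exact LinearMap.mem_range_self _ _
  rw [LinearMap.mem_ker] at this
  simp only [Matrix.mulVecLin_apply, Matrix.mulVec_single_one] at this
  exact congrFun this p

theorem splits_of_section (S : CMses A E B) (g : CMHom B E) (hg : ∀ j, S.quo.F j * g.F j = 1) :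
    S.Splits := by
  have key : ∀ j, ∃ C : Matrix (Fin sA) (Fin sE) Rser, 1 - g.F j * S.quo.F j = S.emb.F j * C := fun j =>
    S.exists_emb_mul j (by
      rw [Matrix.mul_sub, ← Matrix.mul_assoc, hg, Matrix.one_mul, Matrix.mul_one, sub_self])
  choose ρ hρ using key
  refine ⟨CMHom.ofY ρ fun j => ?_, fun j => ?_⟩
  · apply S.emb_cancel (j - 1)
    rw [← Matrix.mul_assoc, ← hρ, ← Matrix.mul_assoc, S.emb.hY, Matrix.mul_assoc, ← hρ,
      Matrix.sub_mul, Matrix.mul_sub, Matrix.mul_assoc, S.quo.hY, ← Matrix.mul_assoc, g.hY,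
      Matrix.one_mul, Matrix.mul_one, Matrix.mul_assoc]
  · apply S.emb_cancel j
    change S.emb.F j * (ρ j * S.emb.F j) = _
    rw [← Matrix.mul_assoc, ← hρ, Matrix.sub_mul, Matrix.mul_assoc, S.quo_mul_emb, Matrix.mul_zero,
      sub_zero, Matrix.one_mul, Matrix.mul_one]

/-- Two consecutive steps of an extension, the first killing the quotient modulo `t` and
the second killing the submodule modulo `t`, compose to a multiple of `t`. -/
theorem exists_X_mul_X_eq (S : CMses A E B) (j : ZMod n) (hB : B.X j = tser • 1)
    (hA : A.X (j + 1) = tser • 1) : ∃ W : Matrix (Fin sE) (Fin sE) Rser, E.X (j + 1) * E.X j = tser • W := by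
  obtain ⟨u, hu⟩ := S.exists_quo_mul j (S.quo.F (j - 1))
  obtain ⟨z, hz⟩ := S.exists_emb_mul (Z := E.X j - tser • u) j (by
    rw [Matrix.mul_sub, S.quo.hX, Matrix.mul_smul, hu, hB, Matrix.smul_mul, Matrix.one_mul,
      sub_self])
  refine ⟨E.X (j + 1) * u + S.emb.F (j + 1) * z, ?_⟩
  have e := S.emb.hX (j + 1)
  rw [add_sub_cancel_right, hA, Matrix.mul_smul, Matrix.mul_one] at e
  rw [sub_eq_iff_eq_add.1 hz, Matrix.mul_add, ← Matrix.mul_assoc, ← e, Matrix.smul_mul,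
    Matrix.mul_smul, smul_add, add_comm]

/-- If `Y j` is the identity on the submodule and `quo * Z` lies in the image of `Y j`
on the quotient, then `Z` lies in the image of `Y j`. -/
theorem exists_Y_mul_eq (S : CMses A E B) (j : ZMod n) (hA : A.Y j = 1) {b : ℕ}
    {Z : Matrix (Fin sE) (Fin b) Rser} {T : Matrix (Fin sB) (Fin b) Rser}
    (hZ : S.quo.F (j - 1) * Z = B.Y j * T) : ∃ C : Matrix (Fin sE) (Fin b) Rser, E.Y j * C = Z := by
  obtain ⟨u, hu⟩ := S.exists_quo_mul j T
  obtain ⟨z, hz⟩ := S.exists_emb_mul (Z := Z - E.Y j * u) (j - 1) (by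
    rw [Matrix.mul_sub, ← Matrix.mul_assoc, S.quo.hY, Matrix.mul_assoc, hu, hZ, sub_self])
  have e := S.emb.hY j
  rw [hA, Matrix.mul_one] at e
  refine ⟨u + S.emb.F j * z, ?_⟩
  rw [Matrix.mul_add, ← Matrix.mul_assoc, ← e, ← hz, add_sub_cancel]

end CMses

theorem matrix_one_comm (a b : Matrix (Fin 1) (Fin 1) Rser) : a * b = b * a := by
  ext1 p q
  fin_cases p; fin_cases q
  simp [Matrix.mul_apply, mul_comm]

theorem CMHom.exists_inverse {M N : CMMod k n s} (d : CMHom M N)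
    (h : ∀ j, ∃ e : Matrix (Fin s) (Fin s) Rser, d.F j * e = 1) :
    ∃ (d' : CMHom M N) (e : CMHom N M), (∀ j, d'.F j * e.F j = 1) ∧ ∀ j, e.F j * d'.F j = 1 := by
  choose e he using h
  have he' : ∀ j, e j * d.F j = 1 := fun j => mul_eq_one_comm.1 (he j)
  refine ⟨d, CMHom.ofY e fun j => ?_, he, he'⟩
  rw [← Matrix.mul_one (N.Y j), ← he j, ← Matrix.mul_assoc, ← Matrix.mul_assoc, Matrix.mul_assoc _ (N.Y j),
    ← d.hY, ← Matrix.mul_assoc, he', Matrix.one_mul]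

theorem exists_projections {sM sL sN : ℕ} {M : CMMod k n sM} {L : CMMod k n sL}
    {N : CMMod k n sN} (f : CMHom L M) (g : CMHom N M)
    (hfg : ∀ j, Function.Bijective fun p : (Fin sL → Rser) × (Fin sN → Rser) =>
      (f.F j).mulVec p.1 + (g.F j).mulVec p.2) :
    ∃ (r : CMHom M L) (q : CMHom M N), ∀ j, f.F j * r.F j + g.F j * q.F j = 1 ∧
      r.F j * f.F j = 1 ∧ q.F j * f.F j = 0 ∧ r.F j * g.F j = 0 ∧ q.F j * g.F j = 1 := by
  have inj : ∀ (j : ZMod n) {b : ℕ} {a a' : Matrix (Fin sL) (Fin b) Rser}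
      {c c' : Matrix (Fin sN) (Fin b) Rser},
      f.F j * a + g.F j * c = f.F j * a' + g.F j * c' → a = a' ∧ c = c' := by
    intro j b a a' c c' h
    have key : ∀ q, (a.col q, c.col q) = (a'.col q, c'.col q) := by
      intro q
      apply (hfg j).1
      ext1 p
      exact congrFun (congrFun h p) q
    exact ⟨by ext1 p q; exact congrFun (congrArg Prod.fst (key q)) p,
      by ext1 p q; exact congrFun (congrArg Prod.snd (key q)) p⟩
  have surj : ∀ j, ∃ (r : Matrix (Fin sL) (Fin sM) Rser) (q : Matrix (Fin sN) (Fin sM) Rser),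
      f.F j * r + g.F j * q = 1 := by
    intro j
    choose v hv using fun q => (hfg j).2 ((1 : Matrix (Fin sM) (Fin sM) Rser).col q)
    refine ⟨Matrix.of fun p q => (v q).1 p, Matrix.of fun p q => (v q).2 p, ?_⟩
    ext1 p q
    exact congrFun (hv q) p
  choose r q hrq using surj
  have comm : ∀ j, r (j - 1) * M.Y j = L.Y j * r j ∧ q (j - 1) * M.Y j = N.Y j * q j := by
    intro j
    apply inj (j - 1)
    rw [← Matrix.mul_assoc, ← Matrix.mul_assoc, ← Matrix.add_mul, hrq, Matrix.one_mul,
      ← Matrix.mul_assoc, ← Matrix.mul_assoc, f.hY, g.hY, Matrix.mul_assoc, Matrix.mul_assoc,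
      ← Matrix.mul_add, hrq, Matrix.mul_one]
  refine ⟨CMHom.ofY r fun j => (comm j).1, CMHom.ofY q fun j => (comm j).2, fun j => ?_⟩
  have h1 : r j * f.F j = 1 ∧ q j * f.F j = 0 := by
    apply inj j
    rw [← Matrix.mul_assoc, ← Matrix.mul_assoc, ← Matrix.add_mul, hrq]
    simp
  have h2 : r j * g.F j = 0 ∧ q j * g.F j = 1 := by
    apply inj j
    rw [← Matrix.mul_assoc, ← Matrix.mul_assoc, ← Matrix.add_mul, hrq]
    simp
  exact ⟨hrq j, h1.1, h1.2, h2.1, h2.2⟩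

theorem modifyHom_not_isSplitEpi {sA : ℕ} {M : CMMod k n s} {LY : CMMod k n sA} {LX : CMMod k n 1}
    (T : CMses LY M LX) {i : ZMod n} {W : Matrix (Fin s) (Fin s) Rser}
    (hW : M.X (i + 1) * M.X i = tser • W) (h1 : (1 : ZMod n) ≠ 0) (hX1 : LX.X (i + 1) = 1) :
    ¬ IsSplitEpi (modifyHom M i W hW h1) := by
  rintro ⟨γ, hγ⟩
  have h := hγ i
  rw [modifyHom_self] at h
  obtain ⟨u, hu⟩ := T.exists_quo_mul i (1 : Matrix (Fin 1) (Fin 1) Rser)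
  have e := T.quo.hY (i + 1)
  rw [add_sub_cancel_right, CMMod.Y_eq_of_X_eq_one hX1, Matrix.smul_mul, Matrix.one_mul] at e
  refine tser_smul_ne_one (0 : Fin 1) (T.quo.F (i + 1) * (γ.F i * u)) ?_
  rw [← Matrix.smul_mul, ← e, Matrix.mul_assoc, ← Matrix.mul_assoc (M.Y (i + 1)), h,
    Matrix.one_mul, hu]

section Iso

variable {sM : ℕ} {A LA LX LY : CMMod k n 1} {M : CMMod k n sM} {N₀ : CMMod k n s}
  {i : ZMod n} {W : Matrix (Fin s) (Fin s) Rser} {hW : N₀.X (i + 1) * N₀.X i = tser • W}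
  {h1 : (1 : ZMod n) ≠ 0}

/-- A split monomorphism `f` into the middle term of `S` does not factor, modulo the
image of `A`, through the modification. -/
theorem quo_comp_not_dvd (T : CMses LY N₀ LX) (S : CMses A M N₀) (f : CMHom LA M)
    (r : CMHom M LA) (hr : ∀ j, r.F j * f.F j = 1)
    (g : CMHom (modify N₀ i W hW h1) M)
    (hg : ∀ j, S.quo.F j * g.F j = (modifyHom N₀ i W hW h1).F j)
    (hA : A.X i = 1) (hLA : LA.X i = tser • 1) (hLA1 : LA.X (i + 1) = 1)
    (hX1 : LX.X (i + 1) = 1) (hY1 : LY.X (i + 1) = tser • 1) :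
    ¬ ∃ c : Matrix (Fin 1) (Fin 1) Rser, T.quo.F i * (S.quo.F i * f.F i) = tser • c := by
  rintro ⟨c, hc⟩
  have hi : i - 1 ≠ i := by simpa using h1
  obtain ⟨κ, hκ⟩ := T.exists_Y_mul_eq (i + 1) (CMMod.Y_eq_of_X_eq_tser hY1)
    (Z := S.quo.F i * f.F i) (T := c) (by
      rw [add_sub_cancel_right, hc, CMMod.Y_eq_of_X_eq_one hX1, Matrix.smul_mul, Matrix.one_mul])
  have hh : ∀ j, S.quo.F (j - 1) * f.F (j - 1) * LA.Y j = N₀.Y j * (S.quo.F j * f.F j) :=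
    (S.quo.comp f).hY
  let k : CMHom LA (modify N₀ i W hW h1) := CMHom.ofY
    (fun j => if j = i then κ else S.quo.F j * f.F j) (forall_of_self_succ i
      (by simp only [hi, if_true, if_false, hh, modify_Y_self, Matrix.mul_assoc, hκ])
      (by
        have : S.quo.F (i + 1) * f.F (i + 1) = tser • κ := by
          have e := (S.quo.comp f).hX (i + 1)
          rw [add_sub_cancel_right, hLA1, Matrix.mul_one] at e
          refine e.trans ?_
          change N₀.X (i + 1) * (S.quo.F i * f.F i) = _
          rw [← hκ, N₀.X_mul_Y_mul]
        simp [h1, modify_Y_succ, this, CMMod.Y_eq_of_X_eq_one hLA1])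
      (fun j h h' => by
        simp only [h, h', if_false, hh, modify_Y_of_ne h (ne_succ_of_pred_ne h')]))
  have hk : ∀ j, (modifyHom N₀ i W hW h1).F j * k.F j = S.quo.F j * f.F j := by
    intro j
    by_cases h : j = i
    · subst h
      simp [k, modifyHom_self, hκ]
    · simp [k, modifyHom_of_ne h, h]
  have hs : ∀ j, ∃ c : Matrix (Fin 1) (Fin 1) Rser,
      f.F j - g.F j * k.F j = S.emb.F j * c := fun j => S.exists_emb_mul j (by
    rw [Matrix.mul_sub, ← Matrix.mul_assoc, hg, hk, sub_self])
  choose σ hσ using hs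
  have hσi : σ (i - 1) = tser • σ i := by
    apply S.emb_cancel (i - 1)
    have e1 := f.hY i
    have e2 := (g.comp k).hY i
    rw [CMMod.Y_eq_of_X_eq_tser hLA, Matrix.mul_one] at e1 e2
    change g.F (i - 1) * k.F (i - 1) = M.Y i * (g.F i * k.F i) at e2
    rw [← hσ, e1, e2, ← Matrix.mul_sub, hσ, ← Matrix.mul_assoc, ← S.emb.hY,
      CMMod.Y_eq_of_X_eq_one hA, Matrix.mul_assoc, Matrix.smul_mul, Matrix.one_mul]
  have ha : r.F i * g.F i = tser • (r.F (i + 1) * g.F (i + 1)) := by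
    have e := (r.comp g).hX (i + 1)
    rw [add_sub_cancel_right, hLA1, modify_X_succ, Matrix.mul_smul, Matrix.mul_one,
      Matrix.one_mul] at e
    exact e.symm
  have hb : r.F (i - 1) * (g.F (i - 1) * k.F (i - 1)) = r.F i * (g.F i * k.F i) := by
    have e := (r.comp (g.comp k)).hY i
    rw [CMMod.Y_eq_of_X_eq_tser hLA, Matrix.mul_one, Matrix.one_mul] at e
    exact e
  have hc : 1 = r.F (i - 1) * (g.F (i - 1) * k.F (i - 1)) +
      r.F (i - 1) * (S.emb.F (i - 1) * σ (i - 1)) := by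
    rw [← hσ, ← Matrix.mul_add, add_sub_cancel, hr]
  rw [hb, ← Matrix.mul_assoc, ha, hσi, Matrix.smul_mul, Matrix.mul_smul, Matrix.mul_smul,
    ← smul_add] at hc
  exact tser_smul_ne_one 0 _ hc.symm

theorem exists_Y_mul_eq_one_sub (T : CMses LY N₀ LX) (hY1 : LY.X (i + 1) = tser • 1)
    {h : Matrix (Fin s) (Fin 1) Rser} {u : Matrix (Fin 1) (Fin 1) Rser}
    (hu : T.quo.F i * h * u = 1) :
    ∃ v : Matrix (Fin s) (Fin s) Rser, N₀.Y (i + 1) * v = 1 - h * (u * T.quo.F i) :=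
  T.exists_Y_mul_eq (i + 1) (CMMod.Y_eq_of_X_eq_tser hY1) (T := 0) (by
    rw [add_sub_cancel_right, Matrix.mul_sub, ← Matrix.mul_assoc, ← Matrix.mul_assoc, hu]
    simp)

/-- If `f - g h` is divisible by `t` at `i - 1`, then `S` splits. -/
theorem splits_of_dvd (T : CMses LY N₀ LX) (S : CMses A M N₀) (f : CMHom LA M)
    (g : CMHom (modify N₀ i W hW h1) M)
    (hg : ∀ j, S.quo.F j * g.F j = (modifyHom N₀ i W hW h1).F j)
    (hA : A.X i = 1) (hLA : LA.X i = tser • 1) (hX1 : LX.X (i + 1) = 1)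
    (hY1 : LY.X (i + 1) = tser • 1) {u : Matrix (Fin 1) (Fin 1) Rser}
    (hu : T.quo.F i * (S.quo.F i * f.F i) * u = 1) {c : Matrix (Fin 1) (Fin 1) Rser}
    (hc : f.F (i - 1) - g.F (i - 1) * (S.quo.F (i - 1) * f.F (i - 1)) =
      S.emb.F (i - 1) * (tser • c)) : S.Splits := by
  have hi : i - 1 ≠ i := by simpa using h1
  have gY := g.hY i
  rw [modify_Y_self] at gY
  have gY1 := g.hY (i + 1)
  rw [modify_Y_succ, add_sub_cancel_right, Matrix.mul_one] at gY1
  obtain ⟨v, hv⟩ := exists_Y_mul_eq_one_sub T hY1 hu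
  have hh : S.quo.F (i - 1) * f.F (i - 1) = N₀.Y i * (S.quo.F i * f.F i) := by
    have e := (S.quo.comp f).hY i
    rw [CMMod.Y_eq_of_X_eq_tser hLA, Matrix.mul_one] at e
    exact e
  have hfi : M.X i * f.F (i - 1) = tser • f.F i := by
    rw [← f.hX, hLA, Matrix.mul_smul, Matrix.mul_one]
  have hιi : M.X i * S.emb.F (i - 1) = S.emb.F i := by
    rw [← S.emb.hX, hA, Matrix.mul_one]
  have e1 : M.X i * (g.F (i - 1) * (N₀.Y i * N₀.Y (i + 1))) = tser • g.F i := by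
    rw [gY, M.X_mul_Y_mul]
  have e2 : M.X i * (g.F (i - 1) * (N₀.Y i * (S.quo.F i * f.F i))) =
      tser • (f.F i - S.emb.F i * c) := by
    rw [← hh, ← sub_sub_cancel (f.F (i - 1)) (g.F (i - 1) * _), hc, Matrix.mul_sub, hfi,
      ← Matrix.mul_assoc, hιi, Matrix.mul_smul, smul_sub]
  obtain ⟨σ, hσ⟩ : ∃ σ : Matrix (Fin sM) (Fin s) Rser,
      M.X i * (g.F (i - 1) * N₀.Y i) = tser • σ := by
    refine ⟨g.F i * v + (f.F i - S.emb.F i * c) * (u * T.quo.F i), ?_⟩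
    rw [smul_add, ← Matrix.smul_mul, ← Matrix.smul_mul, ← e1, ← e2]
    have : g.F (i - 1) * N₀.Y i = g.F (i - 1) * N₀.Y i *
        (N₀.Y (i + 1) * v + S.quo.F i * f.F i * (u * T.quo.F i)) := by
      rw [hv, sub_add_cancel, Matrix.mul_one]
    rw [this]
    simp only [Matrix.mul_add, Matrix.mul_assoc]
  let sec : CMHom N₀ M := CMHom.ofY (fun j => if j = i then σ else g.F j) (forall_of_self_succ i
    (by
      simp only [hi, if_true, if_false]
      apply tser_smul_cancel
      rw [← Matrix.mul_smul (M.Y i) tser σ, ← hσ, M.Y_mul_X_mul])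
    (by
      simp only [add_sub_cancel_right, if_true, add_eq_left, h1, if_false]
      apply tser_smul_cancel
      rw [← gY1, ← e1, ← Matrix.smul_mul, ← hσ]
      simp only [Matrix.mul_assoc])
    (fun j h h' => by
      simp only [h, h', if_false]
      have := g.hY j
      rwa [modify_Y_of_ne h (ne_succ_of_pred_ne h')] at this))
  refine S.splits_of_section sec fun j => ?_
  by_cases h : j = i
  · subst h
    simp only [sec, CMHom.ofY_F, if_true]
    apply tser_smul_cancel
    rw [← Matrix.mul_smul, ← hσ, ← Matrix.mul_assoc, S.quo.hX, Matrix.mul_assoc,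
      ← Matrix.mul_assoc (S.quo.F (j - 1)), hg, modifyHom_of_ne hi, Matrix.one_mul, N₀.hXY]
  · simp only [sec, CMHom.ofY_F, h, if_false, hg, modifyHom_of_ne h]

/-- The complement of `LA` in the middle term of an almost split sequence is the
modification of the right-hand term. -/
theorem exists_iso_modify [NeZero n] (T : CMses LY N₀ LX) (S : CMses A M N₀) (hS : AlmostSplit S)
    {N : CMMod k n s} (hsum : IsDirectSumOf M LA N)
    (hA : A.X i = 1) (hLA : LA.X i = tser • 1) (hLA1 : LA.X (i + 1) = 1)
    (hALA : ∀ j, j ≠ i → j ≠ i + 1 → A.Y j = LA.Y j)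
    (hX1 : LX.X (i + 1) = 1) (hY1 : LY.X (i + 1) = tser • 1) :
    ∃ (d : CMHom (modify N₀ i W hW h1) N) (e : CMHom N (modify N₀ i W hW h1)),
      (∀ j, d.F j * e.F j = 1) ∧ ∀ j, e.F j * d.F j = 1 := by
  obtain ⟨f, gN, hfg⟩ := hsum
  obtain ⟨r, q, hrq⟩ := exists_projections f gN hfg
  obtain ⟨hns, -, -, hlift⟩ := hS
  obtain ⟨g, hg⟩ := hlift _ _ _ (modifyHom_not_isSplitEpi T hW h1 hX1)
  have hi : i - 1 ≠ i := by simpa using h1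
  obtain ⟨u, hu⟩ := (matrix_one_dichotomy (T.quo.F i * (S.quo.F i * f.F i))).resolve_left
    (quo_comp_not_dvd T S f r (fun j => (hrq j).2.1) g hg hA hLA hLA1 hX1 hY1)
  have hc : ∀ j, ∃ c : Matrix (Fin 1) (Fin 1) Rser, j ≠ i →
      f.F j - g.F j * (S.quo.F j * f.F j) = S.emb.F j * c := by
    intro j
    by_cases h : j = i
    · exact ⟨0, fun h' => (h' h).elim⟩
    · obtain ⟨c, hc⟩ := S.exists_emb_mul (Z := f.F j - g.F j * (S.quo.F j * f.F j)) j (by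
        rw [Matrix.mul_sub, ← Matrix.mul_assoc, hg, modifyHom_of_ne h, Matrix.one_mul, sub_self])
      exact ⟨c, fun _ => hc⟩
  choose c hc using hc
  have hconst : ∀ j, j ≠ i → c j = c (i - 1) := by
    refine zmod_pred_induction (i - 1) (fun _ => rfl) fun j ih h' => ?_
    by_cases h : j = i
    · rw [h]
    · rw [← ih h]
      have hj := ne_succ_of_pred_ne h'
      apply LA.Y_cancel j
      rw [matrix_one_comm, ← hALA j h hj]
      apply S.emb_cancel (j - 1)
      have e1 : S.quo.F (j - 1) * (f.F (j - 1) * LA.Y j) = N₀.Y j * (S.quo.F j * f.F j) := by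
        rw [f.hY, ← Matrix.mul_assoc, S.quo.hY, Matrix.mul_assoc]
      have e2 := g.hY j
      rw [modify_Y_of_ne h hj] at e2
      rw [← Matrix.mul_assoc, ← hc _ h', hALA j h hj, Matrix.sub_mul, f.hY, Matrix.mul_assoc,
        Matrix.mul_assoc, e1, ← Matrix.mul_assoc, e2, Matrix.mul_assoc, ← Matrix.mul_sub, hc j h,
        ← Matrix.mul_assoc, ← S.emb.hY, hALA j h hj, Matrix.mul_assoc]
  obtain ⟨c', hc'⟩ := (matrix_one_dichotomy (c (i - 1))).resolve_left fun ⟨c', h⟩ =>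
    hns (splits_of_dvd T S f g hg hA hLA hX1 hY1 hu (h ▸ hc (i - 1) hi))
  have hemb0 : ∀ j, j ≠ i → S.emb.F j =
      f.F j * c' - g.F j * (S.quo.F j * f.F j * c') := fun j h => by
    rw [← Matrix.mul_assoc, ← Matrix.sub_mul, hc j h, hconst j h, Matrix.mul_assoc, hc',
      Matrix.mul_one]
  have hemb : ∀ j, ∃ (a : Matrix (Fin 1) (Fin 1) Rser) (b : Matrix (Fin s) (Fin 1) Rser),
      f.F j * a + g.F j * b = S.emb.F j := by
    intro j
    by_cases h : j = i
    · subst h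
      have e := S.emb.hX j
      rw [hA, Matrix.mul_one, hemb0 _ hi, Matrix.mul_sub, ← Matrix.mul_assoc, ← f.hX,
        ← Matrix.mul_assoc (M.X j) (g.F _), ← g.hX, Matrix.mul_assoc, Matrix.mul_assoc,
        sub_eq_add_neg, ← Matrix.mul_neg] at e
      exact ⟨_, _, e.symm⟩
    · exact ⟨c', -(S.quo.F j * f.F j * c'), by rw [hemb0 j h, Matrix.mul_neg, ← sub_eq_add_neg]⟩
  have hquo : ∀ j, ∃ (a : Matrix (Fin 1) (Fin s) Rser) (b : Matrix (Fin s) (Fin s) Rser),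
      S.quo.F j * (f.F j * a + g.F j * b) = 1 := by
    intro j
    by_cases h : j = i
    · subst h
      obtain ⟨v, hv⟩ := exists_Y_mul_eq_one_sub T hY1 hu
      refine ⟨u * T.quo.F j, v, ?_⟩
      rw [Matrix.mul_add, ← Matrix.mul_assoc _ (g.F j), hg, modifyHom_self, hv,
        ← Matrix.mul_assoc, add_sub_cancel]
    · exact ⟨0, 1, by rw [Matrix.mul_zero, zero_add, Matrix.mul_one, hg, modifyHom_of_ne h]⟩
  apply (q.comp g).exists_inverse
  intro j
  obtain ⟨a, b, hab⟩ := hemb j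
  obtain ⟨a', b', hab'⟩ := hquo j
  obtain ⟨C, hC⟩ := S.exists_emb_mul
    (Z := gN.F j - (f.F j * a' + g.F j * b') * (S.quo.F j * gN.F j)) j (by
      rw [Matrix.mul_sub, ← Matrix.mul_assoc _ _ (S.quo.F j * gN.F j), hab', Matrix.one_mul,
        sub_self])
  obtain ⟨-, -, hqf, -, hqg⟩ := hrq j
  refine ⟨b * C + b' * (S.quo.F j * gN.F j), ?_⟩
  have e := congrArg (q.F j * ·) (sub_eq_iff_eq_add.1 hC)
  simp only [← hab, hqg, Matrix.add_mul, Matrix.mul_add, ← Matrix.mul_assoc, hqf,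
    Matrix.zero_mul, zero_add] at e
  change q.F j * g.F j * _ = 1
  rw [e]
  simp only [Matrix.mul_add, ← Matrix.mul_assoc]

end Iso

theorem HasFiltration.exists_extension {M : CMMod k n s} {I J : Finset (ZMod n)}
    (h : HasFiltration M [I, J]) : ∃ L K : CMMod k n 1, IsRankOne I L ∧ IsRankOne J K ∧
      Nonempty (CMses K M L) := by
  cases h with
  | step hQ hK hS =>
    cases hK with
    | base hK => exact ⟨_, _, hQ, hK, hS⟩
    | step _ h0 _ => cases h0

theorem Indecomposable.of_iso {M N : CMMod k n s} (hM : Indecomposable M) (d : CMHom M N)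
    (e : CMHom N M) (hde : ∀ j, d.F j * e.F j = 1) : Indecomposable N := by
  intro f hf
  have key : ∀ j, f.F j = d.F j * (e.F j * (f.F j * d.F j)) * e.F j := fun j => by
    simp only [← Matrix.mul_assoc, hde, Matrix.one_mul]
    rw [Matrix.mul_assoc, hde, Matrix.mul_one]
  refine (hM (e.comp (f.comp d)) fun j => ?_).imp (fun h j => ?_) (fun h j => ?_)
  · change e.F j * (f.F j * d.F j) * (e.F j * (f.F j * d.F j)) = e.F j * (f.F j * d.F j)
    rw [Matrix.mul_assoc, Matrix.mul_assoc, ← Matrix.mul_assoc (d.F j), hde, Matrix.one_mul,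
      ← Matrix.mul_assoc (f.F j), hf]
  · have := h j
    change e.F j * (f.F j * d.F j) = 0 at this
    rw [key, this]
    simp
  · have := h j
    change e.F j * (f.F j * d.F j) = 1 at this
    rw [key, this, Matrix.mul_one, hde]

theorem HasFiltration.of_iso {M N : CMMod k n s} {I : Finset (ZMod n)} {rest} (hrest : rest ≠ [])
    (hM : HasFiltration M (I :: rest)) (d : CMHom M N) (e : CMHom N M)
    (hde : ∀ j, d.F j * e.F j = 1) (hed : ∀ j, e.F j * d.F j = 1) :
    HasFiltration N (I :: rest) := by
  cases hM with
  | base h => exact (hrest rfl).elim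
  | step hQ hK hS =>
    obtain ⟨S⟩ := hS
    have hd : ∀ j v, (e.F j).mulVec ((d.F j).mulVec v) = v := fun j v => by
      rw [Matrix.mulVec_mulVec, hed, Matrix.one_mulVec]
    have he : ∀ j v, (d.F j).mulVec ((e.F j).mulVec v) = v := fun j v => by
      rw [Matrix.mulVec_mulVec, hde, Matrix.one_mulVec]
    refine .step hQ hK ⟨⟨d.comp S.emb, S.quo.comp e, fun j => ?_, fun j => ?_, fun j => ?_⟩⟩
    · change Function.Injective (d.F j * S.emb.F j).mulVecLin
      rw [Matrix.mulVecLin_mul]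
      exact (Function.LeftInverse.injective (hd j)).comp (S.inj j)
    · change LinearMap.range (d.F j * S.emb.F j).mulVecLin =
        LinearMap.ker (S.quo.F j * e.F j).mulVecLin
      ext v
      have h := SetLike.ext_iff.1 (S.exactness j) ((e.F j).mulVec v)
      rw [LinearMap.mem_range, LinearMap.mem_ker] at h
      rw [LinearMap.mem_range, LinearMap.mem_ker, Matrix.mulVecLin_mul, Matrix.mulVecLin_mul,
        LinearMap.comp_apply, Matrix.mulVecLin_apply (e.F j), ← h]
      refine exists_congr fun w => ⟨fun hw => ?_, fun hw => ?_⟩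
      · rw [← hw]
        exact (hd j _).symm
      · exact (congrArg (d.F j).mulVec hw).trans (he j v)
    · change Function.Surjective (S.quo.F j * e.F j).mulVecLin
      rw [Matrix.mulVecLin_mul]
      exact (S.surj j).comp (Function.RightInverse.surjective (hd j))

theorem Indecomposable.modify {M : CMMod k n s} (hM : Indecomposable M) {i : ZMod n}
    {W : Matrix (Fin s) (Fin s) Rser} (hW : M.X (i + 1) * M.X i = tser • W)
    (h1 : (1 : ZMod n) ≠ 0) {U : Matrix (Fin s) (Fin s) Rser} (hU : M.Y i * U = 1) :
    Indecomposable (modify M i W hW h1) := by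
  intro f hf
  have hU' : U * M.Y i = 1 := mul_eq_one_comm.1 hU
  have hi : i - 1 ≠ i := by simpa using h1
  have fY := f.hY i
  rw [modify_Y_self] at fY
  have fY1 := f.hY (i + 1)
  rw [modify_Y_succ, add_sub_cancel_right, Matrix.mul_one, Matrix.one_mul] at fY1
  let g : CMHom M M := CMHom.ofY (fun j => if j = i then U * (f.F (i - 1) * M.Y i) else f.F j)
    (forall_of_self_succ i
      (by simp only [hi, if_true, if_false]; rw [← Matrix.mul_assoc, hU, Matrix.one_mul])
      (by
        simp only [add_sub_cancel_right, if_true, add_eq_left, h1, if_false]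
        rw [← fY1, Matrix.mul_assoc, Matrix.mul_assoc, fY, ← Matrix.mul_assoc, ← Matrix.mul_assoc,
          hU', Matrix.one_mul])
      (fun j h h' => by
        simp only [h, h', if_false]
        have := f.hY j
        rwa [modify_Y_of_ne h (ne_succ_of_pred_ne h')] at this))
  have hg : ∀ j, j ≠ i → g.F j = f.F j := fun j h => by simp [g, h]
  have hi' : i + 1 ≠ i := by simpa using h1
  refine (hM g fun j => ?_).imp (fun h j => ?_) (fun h j => ?_)
  · by_cases h : j = i
    · subst h
      simp only [g, CMHom.ofY_F, if_true]
      rw [Matrix.mul_assoc, ← Matrix.mul_assoc _ U, Matrix.mul_assoc _ _ U, hU, Matrix.mul_one,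
        ← Matrix.mul_assoc (f.F _), hf]
    · rw [hg j h, hf]
  · by_cases h' : j = i
    · rw [h', fY1, ← hg _ hi', h]
    · rw [← hg j h', h]
  · by_cases h' : j = i
    · rw [h', fY1, ← hg _ hi', h]
    · rw [← hg j h', h]

theorem CMMod.cancel_Y (M : CMMod k n s) (j : ZMod n) {b : ℕ} {Z Z' : Matrix (Fin b) (Fin s) Rser}
    (h : Z * M.Y j = Z' * M.Y j) : Z = Z' := by
  have := congrArg (· * M.X j) h
  simp only [Matrix.mul_assoc, M.hYX, Matrix.mul_smul, Matrix.mul_one] at this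
  exact tser_smul_cancel this

theorem CMHom.idempotent_of_idempotent_at [NeZero n] {M : CMMod k n s} (f : CMHom M M) (i : ZMod n)
    (h : f.F i * f.F i = f.F i) (j : ZMod n) : f.F j * f.F j = f.F j := by
  refine zmod_pred_induction (P := fun j => f.F j * f.F j = f.F j) i h (fun j hj => ?_) j
  apply M.cancel_Y j
  rw [Matrix.mul_assoc, f.hY, ← Matrix.mul_assoc, f.hY, Matrix.mul_assoc, hj]

section Six

variable {N₀ : CMMod 3 6 2} {LX LY : CMMod 3 6 1} {i : ZMod 6}

/-- Two leaves of the module at the vertices `i + 2` and `i + 4` are respected by a common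
rank-one idempotent at the vertex `i + 1`. -/
theorem exists_rank_one_idempotent (T : CMses LY N₀ LX)
    (hX2 : LX.X (i + 2) = tser • 1) (hX3 : LX.X (i + 3) = 1)
    (hX4 : LX.X (i + 4) = tser • 1) (hY4 : LY.X (i + 4) = 1)
    {U U' : Matrix (Fin 2) (Fin 2) Rser} (hU : N₀.X (i + 3) * N₀.X (i + 2) = tser • U)
    (hUU' : U * U' = 1) :
    ∃ (v : Matrix (Fin 2) (Fin 1) Rser) (α : Matrix (Fin 1) (Fin 2) Rser)
      (φ₂ φ₄ : Matrix (Fin 2) (Fin 2) Rser), α * v = 1 ∧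
      φ₂ * N₀.X (i + 2) = N₀.X (i + 2) * (v * α) ∧
      φ₄ * N₀.X (i + 4) = N₀.X (i + 4) * (U * (v * α) * U') := by
  have s2 : i + 2 - 1 = i + 1 := by ring
  have s3 : i + 3 - 1 = i + 2 := by ring
  have s4 : i + 4 - 1 = i + 3 := by ring
  have hU'U : U' * U = 1 := mul_eq_one_comm.1 hUU'
  obtain ⟨a, ha⟩ := T.exists_quo_mul (i + 2) (1 : Matrix (Fin 1) (Fin 1) Rser)
  obtain ⟨b, hb⟩ := T.exists_quo_mul (i + 4) (1 : Matrix (Fin 1) (Fin 1) Rser)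
  have hv : T.quo.F (i + 1) * (N₀.Y (i + 2) * a) = 1 := by
    have e := T.quo.hY (i + 2)
    rw [s2, CMMod.Y_eq_of_X_eq_tser hX2, Matrix.one_mul] at e
    rw [← Matrix.mul_assoc, e, ha]
  have hw : T.quo.F (i + 3) * (N₀.Y (i + 4) * b) = 1 := by
    have e := T.quo.hY (i + 4)
    rw [s4, CMMod.Y_eq_of_X_eq_tser hX4, Matrix.one_mul] at e
    rw [← Matrix.mul_assoc, e, hb]
  have hqU : T.quo.F (i + 3) * U = T.quo.F (i + 1) := by
    have e2 := T.quo.hX (i + 2)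
    have e3 := T.quo.hX (i + 3)
    rw [s2, hX2, Matrix.smul_mul, Matrix.one_mul] at e2
    rw [s3, hX3, Matrix.one_mul] at e3
    apply tser_smul_cancel
    rw [← e2, ← Matrix.mul_smul, ← hU, ← Matrix.mul_assoc, e3]
  set v := N₀.Y (i + 2) * a with hvdef
  set w := U' * (N₀.Y (i + 4) * b) with hwdef
  have hUw : U * w = N₀.Y (i + 4) * b := by
    rw [hwdef, ← Matrix.mul_assoc, hUU', Matrix.one_mul]
  have hqw : T.quo.F (i + 1) * w = 1 := by
    rw [← hqU, Matrix.mul_assoc, hUw, hw]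
  obtain ⟨z, hz⟩ := T.exists_emb_mul (Z := v - w) (i + 1) (by
    rw [Matrix.mul_sub, hv, hqw, sub_self])
  have main : ∃ α : Matrix (Fin 1) (Fin 2) Rser, α * v = 1 ∧
      ∃ ψ : Matrix (Fin 2) (Fin 2) Rser,
        N₀.X (i + 4) * (U * (v * α) * U') * N₀.Y (i + 4) = tser • ψ := by
    rcases matrix_one_dichotomy z with ⟨z', rfl⟩ | ⟨z', hz'⟩
    · refine ⟨T.quo.F (i + 1), hv, (b + N₀.X (i + 4) * (U * (T.emb.F (i + 1) * z'))) *
        (T.quo.F (i + 1) * (U' * N₀.Y (i + 4))), ?_⟩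
      have hXv : N₀.X (i + 4) * (U * v) =
          tser • (b + N₀.X (i + 4) * (U * (T.emb.F (i + 1) * z'))) := by
        rw [sub_eq_iff_eq_add.1 hz, Matrix.mul_add, hUw, Matrix.mul_add, N₀.X_mul_Y_mul]
        simp only [Matrix.mul_smul, smul_add]
        rw [add_comm]
      rw [← Matrix.smul_mul, ← hXv]
      simp only [Matrix.mul_assoc]
    · obtain ⟨ε, hε⟩ := T.exists_emb_mul (Z := 1 - w * T.quo.F (i + 1)) (i + 1) (by
        rw [Matrix.mul_sub, ← Matrix.mul_assoc, hqw, Matrix.one_mul, Matrix.mul_one, sub_self])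
      have hεw : ε * w = 0 := by
        apply T.emb_cancel (i + 1)
        rw [← Matrix.mul_assoc, ← hε, Matrix.sub_mul, Matrix.mul_assoc, hqw]
        simp
      have hεv : ε * v = z := by
        apply T.emb_cancel (i + 1)
        rw [← Matrix.mul_assoc, ← hε, Matrix.sub_mul, Matrix.mul_assoc, hv, ← hz]
        simp
      obtain ⟨ε₄, hε₄⟩ := T.exists_emb_mul (Z := 1 - b * T.quo.F (i + 4)) (i + 4) (by
        rw [Matrix.mul_sub, ← Matrix.mul_assoc, hb, Matrix.one_mul, Matrix.mul_one, sub_self])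
      have hY : N₀.Y (i + 4) =
          N₀.Y (i + 4) * b * T.quo.F (i + 4) + tser • (T.emb.F (i + 3) * ε₄) := by
        have e := T.emb.hY (i + 4)
        rw [s4, CMMod.Y_eq_of_X_eq_one hY4, Matrix.mul_smul, Matrix.mul_one] at e
        rw [← Matrix.smul_mul, e, Matrix.mul_assoc, Matrix.mul_assoc, ← hε₄, ← Matrix.mul_add,
          add_sub_cancel, Matrix.mul_one]
      have hεY : ε * (U' * N₀.Y (i + 4)) = tser • (ε * (U' * (T.emb.F (i + 3) * ε₄))) := by
        rw [hY, Matrix.mul_add, ← Matrix.mul_assoc U', ← hwdef, Matrix.mul_add,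
          ← Matrix.mul_assoc, hεw, Matrix.zero_mul, zero_add, Matrix.mul_smul, Matrix.mul_smul]
      refine ⟨z' * ε, by rw [Matrix.mul_assoc, hεv, matrix_one_comm, hz'],
        N₀.X (i + 4) * (U * (v * (z' * (ε * (U' * (T.emb.F (i + 3) * ε₄)))))), ?_⟩
      simp only [Matrix.mul_assoc, hεY, Matrix.mul_smul]
  obtain ⟨α, hα, ψ, hψ⟩ := main
  refine ⟨v, α, a * (α * N₀.Y (i + 2)), ψ, hα, ?_, ?_⟩
  · rw [← Matrix.mul_assoc (N₀.X _), hvdef, N₀.X_mul_Y_mul, Matrix.mul_assoc, Matrix.mul_assoc,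
      N₀.hYX]
    simp
  · apply tser_smul_cancel
    rw [← Matrix.smul_mul, ← hψ, Matrix.mul_assoc, N₀.hYX]
    simp

theorem forall_zmod_six {P : ZMod 6 → Prop} (i : ZMod 6) (h0 : P i) (h1 : P (i + 1))
    (h2 : P (i + 2)) (h3 : P (i + 3)) (h4 : P (i + 4)) (h5 : P (i + 5)) (j : ZMod 6) : P j := by
  have key : ∀ m : ZMod 6, m = 0 ∨ m = 1 ∨ m = 2 ∨ m = 3 ∨ m = 4 ∨ m = 5 := by decide
  have hj : j = i + (j - i) := by ring
  rcases key (j - i) with h | h | h | h | h | h <;> rw [hj, h]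
  · simpa using h0
  all_goals assumption

theorem modify_six_not_indecomposable (T : CMses LY N₀ LX) {W : Matrix (Fin 2) (Fin 2) Rser}
    (hW : N₀.X (i + 1) * N₀.X i = tser • W) (h1 : (1 : ZMod 6) ≠ 0)
    (hX2 : LX.X (i + 2) = tser • 1) (hX3 : LX.X (i + 3) = 1)
    (hX4 : LX.X (i + 4) = tser • 1) (hY3 : LY.X (i + 3) = tser • 1) (hY4 : LY.X (i + 4) = 1)
    (hY5 : LY.X (i + 5) = tser • 1) : ¬ Indecomposable (modify N₀ i W hW h1) := by
  have s2 : i + 2 - 1 = i + 1 := by ring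
  have s3 : i + 3 - 1 = i + 2 := by ring
  have s4 : i + 4 - 1 = i + 3 := by ring
  have s5 : i + 5 - 1 = i + 4 := by ring
  have t3 : i + 2 + 1 = i + 3 := by ring
  have t5 : i + 4 + 1 = i + 5 := by ring
  have hne : ∀ m m' : ZMod 6, m ≠ m' → i + m ≠ i + m' := fun m m' h h' => h (add_left_cancel h')
  have hne0 : ∀ m : ZMod 6, m ≠ 0 → i + m ≠ i := fun m h h' => h (by simpa using h')
  have d2 := hne0 2 (by decide)
  have d3 := hne0 3 (by decide)
  have d4 := hne0 4 (by decide)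
  have d5 := hne0 5 (by decide)
  have d21 := hne 2 1 (by decide)
  have d31 := hne 3 1 (by decide)
  have d41 := hne 4 1 (by decide)
  have d51 := hne 5 1 (by decide)
  obtain ⟨U, hU⟩ := T.exists_X_mul_X_eq (i + 2) hX2 (t3 ▸ hY3)
  obtain ⟨V, hV⟩ := T.exists_X_mul_X_eq (i + 4) hX4 (t5 ▸ hY5)
  rw [t3] at hU
  rw [t5] at hV
  set P := modify N₀ i W hW h1 with hP
  have hWVU : W * (V * U) = 1 := by
    have hc := P.hcyc i
    have e : ∀ X : ZMod 6 → Matrix (Fin 2) (Fin 2) Rser, cycProd X i =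
        X i * (X (i + 5) * (X (i + 4) * (X (i + 3) * (X (i + 2) * X (i + 1))))) := by
      intro X
      have c1 : i - 1 = i + 5 := by rw [sub_eq_add_neg]; rfl
      have c2 : i - 2 = i + 4 := by rw [sub_eq_add_neg]; rfl
      have c3 : i - 3 = i + 3 := by rw [sub_eq_add_neg]; rfl
      have c4 : i - 4 = i + 2 := by rw [sub_eq_add_neg]; rfl
      have c5 : i - 5 = i + 1 := by rw [sub_eq_add_neg]; rfl
      simp [cycProd, List.range_succ, c1, c2, c3, c4, c5]
    rw [e, hP, modify_X_self, modify_X_succ, modify_X_of_ne d2 d21, modify_X_of_ne d3 d31,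
      modify_X_of_ne d4 d41, modify_X_of_ne d5 d51, ← Matrix.mul_assoc (N₀.X (i + 3)), hU,
      ← Matrix.mul_assoc (N₀.X (i + 5)), hV] at hc
    simp only [Matrix.mul_smul, Matrix.smul_mul, Matrix.mul_one, smul_smul] at hc
    apply tser_smul_cancel
    apply tser_smul_cancel
    apply tser_smul_cancel
    rw [smul_smul, smul_smul, hc]
    simp only [smul_smul]
    congr 1
    ring
  have hUU' : U * (W * V) = 1 := mul_eq_one_comm.1 (by rw [Matrix.mul_assoc, hWVU])
  have hVV' : V * (U * W) = 1 := by
    rw [← Matrix.mul_assoc]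
    exact mul_eq_one_comm.1 hWVU
  have hU'U : W * V * U = 1 := mul_eq_one_comm.1 hUU'
  have hV'V : U * W * V = 1 := mul_eq_one_comm.1 hVV'
  obtain ⟨v, α, φ₂, φ₄, hα, hφ₂, hφ₄⟩ :=
    exists_rank_one_idempotent T hX2 hX3 hX4 hY4 hU hUU'
  set φ₃ := U * (v * α) * (W * V) with hφ₃
  set φ₅ := V * φ₃ * (U * W) with hφ₅
  let F : ZMod 6 → Matrix (Fin 2) (Fin 2) Rser := fun j =>
    if j = i + 2 then φ₂ else if j = i + 3 then φ₃ else if j = i + 4 then φ₄ else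
    if j = i + 5 then φ₅ else v * α
  have F0 : F i = v * α := by simp [F, d2.symm, d3.symm, d4.symm, d5.symm]
  have F1 : F (i + 1) = v * α := by simp [F, d21.symm, d31.symm, d41.symm, d51.symm]
  have F2 : F (i + 2) = φ₂ := by simp [F]
  have F3 : F (i + 3) = φ₃ := by simp [F, hne 3 2 (by decide)]
  have F4 : F (i + 4) = φ₄ := by simp [F, hne 4 2 (by decide), hne 4 3 (by decide)]
  have F5 : F (i + 5) = φ₅ := by
    simp [F, hne 5 2 (by decide), hne 5 3 (by decide), hne 5 4 (by decide)]
  let f : CMHom P P := CMHom.ofX F (forall_zmod_six i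
    (by
      have : i - 1 = i + 5 := by rw [sub_eq_add_neg]; rfl
      rw [this, hP, modify_X_self, F0, F5, hφ₅, hφ₃]
      have e : W * (V * (U * (v * α) * (W * V)) * (U * W)) =
          W * (V * U) * (v * α) * ((W * (V * U)) * W) := by
        simp only [Matrix.mul_assoc]
      rw [e, hWVU, Matrix.one_mul, Matrix.one_mul])
    (by
      rw [add_sub_cancel_right, hP, modify_X_succ, F0, F1]
      simp)
    (by rw [s2, hP, modify_X_of_ne d2 d21, F1, F2, hφ₂])
    (by
      rw [s3, hP, modify_X_of_ne d3 d31, F2, F3]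
      apply N₀.cancel_X (i + 2)
      rw [Matrix.mul_assoc φ₃, hU, Matrix.mul_assoc (N₀.X (i + 3)) φ₂, hφ₂,
        ← Matrix.mul_assoc (N₀.X (i + 3)), hU, hφ₃, Matrix.mul_smul, Matrix.mul_assoc _ (W * V),
        hU'U, Matrix.mul_one, Matrix.smul_mul])
    (by rw [s4, hP, modify_X_of_ne d4 d41, F3, F4, hφ₄])
    (by
      rw [s5, hP, modify_X_of_ne d5 d51, F4, F5]
      apply N₀.cancel_X (i + 4)
      rw [Matrix.mul_assoc φ₅, hV, Matrix.mul_assoc (N₀.X (i + 5)) φ₄, hφ₄,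
        ← Matrix.mul_assoc (N₀.X (i + 5)), hV, hφ₅, Matrix.mul_smul, Matrix.mul_assoc _ (U * W),
        hV'V, Matrix.mul_one, Matrix.smul_mul]))
  have hf1 : f.F (i + 1) = v * α := F1
  have htr : (v * α).trace = 1 := by
    rw [Matrix.trace_mul_comm, hα]
    simp
  intro hind
  rcases hind f (f.idempotent_of_idempotent_at (i + 1) (by
    rw [hf1, Matrix.mul_assoc, ← Matrix.mul_assoc α, hα, Matrix.one_mul])) with h | h
  · rw [← hf1, h] at htr
    simp at htr
  · rw [← hf1, h, Matrix.trace_one, Fintype.card_fin] at htr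
    have h2 := congrArg (PowerSeries.constantCoeff (R := ℂ)) htr
    rw [map_natCast, map_one, Nat.cast_eq_one] at h2
    exact absurd h2 (by decide)

end Six

end Auxiliary

/-- In the almost split sequence `0 → L_I → M → (L_X | L_Y) → 0` for
`I = {i, i+2, i+4}`, if `M ≅ L_A ⊕ N` with `A = {i+1, i+2, i+4}`, then `N` is
indecomposable iff `n ≥ 7`, in which case `N = L_B | L_Y` with `B = {i, i+3, i+5}`. -/
theorem AR_middle_summand (n : ℕ) (hn : 6 ≤ n) (i : ZMod n)
    (A : CMMod 3 n 1) (hA : IsRankOne ({i, i + 2, i + 4} : Finset (ZMod n)) A)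
    (M : CMMod 3 n 3) (N0 : CMMod 3 n 2)
    (hN0 : HasFiltration N0 [({i + 1, i + 3, i + 5} : Finset (ZMod n)),
      {i + 2, i + 4, i + 6}])
    (S : CMses A M N0) (hAR : AlmostSplit S)
    (LA : CMMod 3 n 1) (hLA : IsRankOne ({i + 1, i + 2, i + 4} : Finset (ZMod n)) LA)
    (N : CMMod 3 n 2) (hsum : IsDirectSumOf M LA N) :
    (Indecomposable N ↔ 7 ≤ n) ∧
    (7 ≤ n → HasFiltration N [({i, i + 3, i + 5} : Finset (ZMod n)),
      {i + 2, i + 4, i + 6}]) := by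
  have : NeZero n := ⟨by omega⟩
  have hcast : ∀ a : ℕ, 0 < a → a < 6 → (a : ZMod n) ≠ 0 := fun a h h' h0 =>
    absurd (Nat.le_of_dvd h ((ZMod.natCast_eq_zero_iff a n).1 h0)) (by omega)
  have h1 : (1 : ZMod n) ≠ 0 := by exact_mod_cast hcast 1 (by omega) (by omega)
  have h2 : (2 : ZMod n) ≠ 0 := by exact_mod_cast hcast 2 (by omega) (by omega)
  have h3 : (3 : ZMod n) ≠ 0 := by exact_mod_cast hcast 3 (by omega) (by omega)
  have h4 : (4 : ZMod n) ≠ 0 := by exact_mod_cast hcast 4 (by omega) (by omega)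
  have h5 : (5 : ZMod n) ≠ 0 := by exact_mod_cast hcast 5 (by omega) (by omega)
  have shift : ∀ a b : ZMod n, i + a = i + b ↔ b - a = 0 := fun a b => by
    rw [add_right_inj, sub_eq_zero, eq_comm]
  have e21 : (2 : ZMod n) - 1 = 1 := by ring
  have e31 : (3 : ZMod n) - 1 = 2 := by ring
  have e41 : (4 : ZMod n) - 1 = 3 := by ring
  have e51 : (5 : ZMod n) - 1 = 4 := by ring
  have e61 : (6 : ZMod n) - 1 = 5 := by ring
  obtain ⟨LX, LY, hLX, hLY, ⟨T⟩⟩ := hN0.exists_extension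
  have hAi : A.X i = 1 := by simp [hA.1]
  have hLAi : LA.X i = tser • 1 := by simp [hLA.1, h1, h2, h4]
  have hLAi1 : LA.X (i + 1) = 1 := by simp [hLA.1]
  have hXi : LX.X i = tser • 1 := by simp [hLX.1, h1, h3, h5]
  have hXi1 : LX.X (i + 1) = 1 := by simp [hLX.1]
  have hYi1 : LY.X (i + 1) = tser • 1 := by
    simp [hLY.1, -add_right_inj, shift, e21, e41, e61, h1, h3, h5]
  have hALA : ∀ j, j ≠ i → j ≠ i + 1 → A.Y j = LA.Y j := fun j h h' => by
    simp [hA.2, hLA.2, h, h']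
  obtain ⟨W, hW⟩ := T.exists_X_mul_X_eq i hXi hYi1
  obtain ⟨d, e, hde, hed⟩ := exists_iso_modify (hW := hW) (h1 := h1) T S hAR hsum hAi hLAi hLAi1
    hALA hXi1 hYi1
  refine ⟨⟨fun hN => ?_, fun h7 => ?_⟩, fun h7 => ?_⟩
  · by_contra hlt
    obtain rfl : n = 6 := by omega
    refine modify_six_not_indecomposable T hW h1 ?_ ?_ ?_ ?_ ?_ ?_ (hN.of_iso e d hed)
    · rw [hLX.1, if_neg]
      simp only [Finset.mem_insert, Finset.mem_singleton, add_right_inj]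
      decide
    · simp [hLX.1]
    · rw [hLX.1, if_neg]
      simp only [Finset.mem_insert, Finset.mem_singleton, add_right_inj]
      decide
    · rw [hLY.1, if_neg]
      simp only [Finset.mem_insert, Finset.mem_singleton, add_right_inj]
      decide
    · simp [hLY.1]
    · rw [hLY.1, if_neg]
      simp only [Finset.mem_insert, Finset.mem_singleton, add_right_inj]
      decide
  · have h6 : (6 : ZMod n) ≠ 0 := fun h0 =>
      absurd (Nat.le_of_dvd (by omega) ((ZMod.natCast_eq_zero_iff 6 n).1 (mod_cast h0))) (by omega)
    have hYi : LY.X i = tser • 1 := by simp [hLY.1, h2, h4, h6]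
    obtain ⟨U, hU⟩ := T.exists_Y_mul_eq i (CMMod.Y_eq_of_X_eq_tser hYi) (Z := 1)
      (T := T.quo.F (i - 1)) (by
        rw [CMMod.Y_eq_of_X_eq_tser hXi, Matrix.one_mul, Matrix.mul_one])
    exact (hAR.2.2.1.modify hW h1 hU).of_iso d e hde
  · have h6 : (6 : ZMod n) ≠ 0 := fun h0 =>
      absurd (Nat.le_of_dvd (by omega) ((ZMod.natCast_eq_zero_iff 6 n).1 (mod_cast h0))) (by omega)
    have hYi : LY.X i = tser • 1 := by simp [hLY.1, h2, h4, h6]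
    have hWX : LX.X (i + 1) * LX.X i = tser • 1 := by rw [hXi, hXi1, Matrix.one_mul]
    have hWY : LY.X (i + 1) * LY.X i = tser • (tser • 1) := by
      rw [hYi, hYi1, Matrix.smul_mul, Matrix.one_mul]
    refine HasFiltration.of_iso (by simp) (.step (Q := modify LX i 1 hWX h1) ?_
      (.base (N := modify LY i (tser • 1) hWY h1) ?_)
      ⟨modifySes T i (tser • 1) hWY W hW 1 hWX h1⟩) d e hde hed
    · refine ⟨forall_of_self_succ i ?_ ?_ fun j h h' => ?_,
        forall_of_self_succ i ?_ ?_ fun j h h' => ?_⟩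
      · simp [modify_X_self]
      · simp [modify_X_succ, -add_right_inj, shift, e31, e51, h1, h2, h4]
      · have h'' := ne_succ_of_pred_ne h'
        simp [modify_X_of_ne h h'', hLX.1, h, h'']
      · simp [modify_Y_self, CMMod.Y_eq_of_X_eq_tser hXi, CMMod.Y_eq_of_X_eq_one hXi1]
      · simp [modify_Y_succ, -add_right_inj, shift, e31, e51, h1, h2, h4]
      · have h'' := ne_succ_of_pred_ne h'
        simp [modify_Y_of_ne h h'', hLX.2, h, h'']
    · refine ⟨forall_of_self_succ i ?_ ?_ fun j h h' => ?_,
        forall_of_self_succ i ?_ ?_ fun j h h' => ?_⟩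
      · rw [modify_X_self, ← hLY.1, hYi]
      · rw [modify_X_succ, ← hLY.1, hYi1]
      · rw [modify_X_of_ne h (ne_succ_of_pred_ne h'), hLY.1]
      · rw [modify_Y_self, ← hLY.2, CMMod.Y_eq_of_X_eq_tser hYi1, Matrix.mul_one]
      · rw [modify_Y_succ, ← hLY.2, CMMod.Y_eq_of_X_eq_tser hYi1]
      · rw [modify_Y_of_ne h (ne_succ_of_pred_ne h'), hLY.2]

end GCC
end
end

section
/- Let n ≥ 7 and let I ⊆ ℤ/n be a 3-element subset such that i+1 ∉ I for every i ∈ I (i.e. the rank-1 module L_I has three peaks). Set X = {i−2 : i ∈ I} and Y = {i−1 : i ∈ I} (computed modulo n). Then there exist a rank-3 module M and a rank-2 module N in CM(B_{3,n}) such that N admits the filtration L_X | L_Y and there is an almost split sequence 0 → N → M → L_I → 0. Moreover, if M is indecomposable, then M admits the filtration L_X | L_I | L_Y. -/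
open scoped Classical

noncomputable section

namespace GCC

section Lattice

variable {R K V : Type*} [CommRing R] [Field K]
  [Algebra R K] [IsFractionRing R K] [AddCommGroup V] [Module K V] [Module R V]
  [IsScalarTower R K V]

lemma exists_smul_mem_of_isLattice (B : Submodule R V) [Submodule.IsLattice K B] (w : V) :
    ∃ r : R, r ∈ nonZeroDivisors R ∧ r • w ∈ B := by
  have hw : w ∈ Submodule.span K (B : Set V) := by
    rw [Submodule.IsLattice.span_eq_top]; trivial
  induction hw using Submodule.span_induction with
  | mem x hx => exact ⟨1, one_mem _, by simpa using hx⟩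
  | zero => exact ⟨1, one_mem _, by simp⟩
  | add x y _ _ hx hy =>
    obtain ⟨r, hr, hrx⟩ := hx
    obtain ⟨r', hr', hry⟩ := hy
    refine ⟨r * r', mul_mem hr hr', ?_⟩
    rw [smul_add]
    refine B.add_mem ?_ ?_
    · rw [mul_comm, mul_smul]; exact B.smul_mem _ hrx
    · rw [mul_smul]; exact B.smul_mem _ hry
  | smul a x _ hx =>
    obtain ⟨r, hr, hrx⟩ := hx
    obtain ⟨⟨p, q⟩, hq⟩ := IsLocalization.surj (nonZeroDivisors R) a
    refine ⟨q * r, mul_mem q.2 hr, ?_⟩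
    have : ((q : R) * r) • a • x = p • r • x := by
      rw [← algebraMap_smul K ((q : R) * r), ← algebraMap_smul K p, ← algebraMap_smul K r,
        smul_smul, smul_smul, ← hq, map_mul]
      congr 1
      ring
    rw [this]
    exact B.smul_mem _ hrx

variable [IsDomain R] [IsPrincipalIdealRing R]

lemma exists_extend_of_isLattice (B : Submodule R V) [Submodule.IsLattice K B] (g : B →ₗ[R] K) :
    ∃ ψ : V →ₗ[K] K, ∀ b : B, ψ b = g b := by
  have : Module.IsTorsionFree R K := inferInstance
  let b := Module.Free.chooseBasis R B
  refine ⟨(b.extendOfIsLattice K).constr K (fun i => g (b i)), fun x => ?_⟩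
  have h : (((b.extendOfIsLattice K).constr K (fun i => g (b i))).restrictScalars R).comp
      B.subtype = g := by
    refine b.ext fun i => ?_
    have := (b.extendOfIsLattice K).constr_basis K (fun i => g (b i)) i
    rw [Module.Basis.extendOfIsLattice_apply] at this
    simpa using this
  exact LinearMap.congr_fun h x

/-- The dual of a finite intersection of lattices is the sum of the dual lattices. -/
lemma exists_sum_of_integral_on_iInf {κ : Type*} [Fintype κ] [Nonempty κ] (B : κ → Submodule R V)
    [∀ l, Submodule.IsLattice K (B l)] (f : V →ₗ[K] K)
    (hf : ∀ w, (∀ l, w ∈ B l) → f w ∈ (algebraMap R K).range) :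
    ∃ ψ : κ → V →ₗ[K] K, (∀ l, ∀ w ∈ B l, ψ l w ∈ (algebraMap R K).range) ∧
      ∑ l, ψ l = f := by
  have : Module.IsTorsionFree R K := inferInstance
  have : Module.IsTorsionFree R V := Module.IsTorsionFree.trans_faithfulSMul R K V
  obtain ⟨l₀⟩ := ‹Nonempty κ›
  let d : (∀ l, B l) →ₗ[R] (κ → V) :=
    { toFun := fun q l => (q l : V) - q l₀
      map_add' := by intro x y; funext l; simp; abel
      map_smul' := by intro r x; funext l; simp [smul_sub] }
  obtain ⟨s, hs⟩ := Module.projective_lifting_property d.rangeRestrict LinearMap.id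
    d.surjective_rangeRestrict
  let Ψ : (∀ l, B l) →ₗ[R] K := (f.restrictScalars R).comp ((B l₀).subtype.comp
    ((LinearMap.proj l₀).comp (LinearMap.id - s.comp d.rangeRestrict)))
  have hker : ∀ q, d (q - s (d.rangeRestrict q)) = 0 := by
    intro q
    have := congrArg Subtype.val (LinearMap.congr_fun hs (d.rangeRestrict q))
    rw [map_sub]
    exact sub_eq_zero.mpr this.symm
  have hΨ : ∀ q, Ψ q ∈ (algebraMap R K).range := by
    intro q
    refine hf _ fun l => ?_
    have h := congrFun (hker q) l
    have h' : ((q - s (d.rangeRestrict q)) l : V) = ((q - s (d.rangeRestrict q)) l₀ : V) :=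
      sub_eq_zero.mp h
    change ((q - s (d.rangeRestrict q)) l₀ : V) ∈ B l
    rw [← h']
    exact Subtype.prop _
  choose ψ hψ using fun l => exists_extend_of_isLattice (K := K) (B l)
    (Ψ.comp (LinearMap.single R (fun l => B l) l))
  refine ⟨ψ, fun l w hw => ?_, ?_⟩
  · rw [hψ l ⟨w, hw⟩]; exact hΨ _
  · have key : ∀ w, (∀ l, w ∈ B l) → (∑ l, ψ l) w = f w := by
      intro w hw
      let q : ∀ l, B l := fun l => ⟨w, hw l⟩
      have h1 : ∑ l, ψ l w = Ψ q := by
        have : q = ∑ l, Pi.single l (q l) := (Finset.univ_sum_single q).symm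
        rw [this, map_sum]
        exact Finset.sum_congr rfl fun l _ => hψ l (q l)
      have h2 : d.rangeRestrict q = 0 := by
        apply Subtype.ext; funext l; simp [d, q]
      rw [LinearMap.sum_apply, h1]
      simp [Ψ, h2, q]
    ext w
    choose r hr hrw using fun l => exists_smul_mem_of_isLattice (K := K) (B l) w
    have hr0 : algebraMap R K (∏ l, r l) ≠ 0 :=
      (map_ne_zero_iff _ (IsFractionRing.injective R K)).mpr (nonZeroDivisors.ne_zero
        (prod_mem (S := nonZeroDivisors R) fun l (_ : l ∈ Finset.univ) => hr l))
    have h := key ((∏ l, r l) • w) fun l => by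
      rw [← Finset.mul_prod_erase _ _ (Finset.mem_univ l), mul_comm, mul_smul]
      exact (B l).smul_mem _ (hrw l)
    rw [← algebraMap_smul K, map_smul, map_smul] at h
    exact smul_right_injective _ hr0 h

end Lattice

section Cyclic

variable {n : ℕ}

/-- The number of elements of `I` in `{1, …, i}`. -/
def cnt (I : Finset (ZMod n)) (i : ZMod n) : ℕ := {j ∈ I | j ≠ 0 ∧ j.val ≤ i.val}.card

lemma cnt_zero (I : Finset (ZMod n)) : cnt I 0 = 0 := by
  simp [cnt]

variable [NeZero n]

/-- Backward induction around the cycle `ℤ/n`, starting from the elements of `I`. -/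
lemma cyclic_induction_back {I : Finset (ZMod n)} (hI : I.Nonempty) {P : ZMod n → Prop}
    (h0 : ∀ i ∈ I, P i) (h1 : ∀ i, i ∉ I → P (i - 1) → P i) (i : ZMod n) : P i := by
  obtain ⟨a, ha⟩ := hI
  have key : ∀ m : ℕ, P (a + m) := by
    intro m
    induction m with
    | zero => simpa using h0 a ha
    | succ m ih =>
      by_cases h : a + ((m + 1 : ℕ) : ZMod n) ∈ I
      · exact h0 _ h
      · refine h1 _ h ?_
        convert ih using 1
        push_cast; ring
  have := key (i - a).val
  simpa using this

/-- Forward induction around the cycle `ℤ/n`, starting from the predecessors of elements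
of `I`. -/
lemma cyclic_induction_forward {I : Finset (ZMod n)} (hI : I.Nonempty) {P : ZMod n → Prop}
    (h0 : ∀ i, i + 1 ∈ I → P i) (h1 : ∀ i, i + 1 ∉ I → P (i + 1) → P i) (i : ZMod n) : P i := by
  have := cyclic_induction_back (I := I.image (fun a => 1 - a)) (hI.image _) (P := fun i => P (-i))
    (fun j hj => by
      obtain ⟨a, ha, rfl⟩ := Finset.mem_image.mp hj
      exact h0 _ (by simpa using ha))
    (fun j hj h => by
      refine h1 _ (fun h' => hj ?_) (by convert h using 1; ring)
      exact Finset.mem_image.mpr ⟨_, h', by ring⟩) (-i)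
  simpa using this

lemma eq_of_eq_pred {α : Type*} {C : ZMod n → α} (h : ∀ i, C i = C (i - 1)) (i j : ZMod n) :
    C i = C j :=
  cyclic_induction_back (I := {j}) (P := fun i => C i = C j) ⟨j, by simp⟩ (by simp)
    (fun i _ hi => (h i).trans hi) i

lemma val_pred (hn : 1 < n) {i : ZMod n} (hi : i ≠ 0) : (i - 1).val + 1 = i.val := by
  have : Fact (1 < n) := ⟨hn⟩
  have h1 : 1 ≤ i.val := Nat.one_le_iff_ne_zero.mpr (by simpa using hi)
  rw [ZMod.val_sub (by rwa [ZMod.val_one]), ZMod.val_one]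
  omega

lemma val_neg_one_add_one : (-1 : ZMod n).val + 1 = n := by
  obtain ⟨m, rfl⟩ := Nat.exists_eq_succ_of_ne_zero (NeZero.ne n)
  rw [ZMod.val_neg_one]

lemma cnt_pred (hn : 1 < n) (I : Finset (ZMod n)) {i : ZMod n} (hi : i ≠ 0) :
    cnt I i = cnt I (i - 1) + if i ∈ I then 1 else 0 := by
  have hv := val_pred hn hi
  have hnot : i ∉ ({j ∈ I | j ≠ 0 ∧ j.val ≤ (i - 1).val} : Finset (ZMod n)) := by
    simp; omega
  have hj : ∀ j : ZMod n, j.val ≤ i.val ↔ (j.val ≤ (i - 1).val ∨ j = i) := by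
    intro j
    rw [← (ZMod.val_injective n).eq_iff]
    omega
  unfold cnt
  split_ifs with h
  · rw [← Finset.card_insert_of_notMem hnot]
    congr 1
    ext j
    simp only [Finset.mem_filter, Finset.mem_insert, hj]
    constructor
    · tauto
    · rintro (rfl | h') <;> tauto
  · rw [add_zero]
    congr 1
    ext j
    simp only [Finset.mem_filter, hj]
    constructor
    · rintro ⟨h1, h2, h3 | rfl⟩ <;> tauto
    · tauto

lemma cnt_neg_one (I : Finset (ZMod n)) :
    cnt I (-1) + (if (0 : ZMod n) ∈ I then 1 else 0) = I.card := by
  have h : ({j ∈ I | j ≠ 0 ∧ j.val ≤ (-1 : ZMod n).val} : Finset (ZMod n)) = I.erase 0 := by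
    ext j
    have := ZMod.val_lt j
    have := val_neg_one_add_one (n := n)
    simp only [Finset.mem_filter, Finset.mem_erase]
    constructor
    · tauto
    · rintro ⟨h1, h2⟩; exact ⟨h2, h1, by omega⟩
  unfold cnt
  rw [h]
  split_ifs with h0
  · exact Finset.card_erase_add_one h0
  · rw [Finset.erase_eq_of_notMem h0, add_zero]

/-- The class of the last element of `I` at or before `i`; the classes of the three elements of
`I` are the three elements of `ℤ/3`. -/
def cls (I : Finset (ZMod n)) (i : ZMod n) : ZMod 3 := cnt I i

lemma cls_pred (hn : 1 < n) {I : Finset (ZMod n)} (hI : I.card = 3) (i : ZMod n) :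
    cls I i = cls I (i - 1) + if i ∈ I then 1 else 0 := by
  unfold cls
  by_cases hi : i = 0
  · subst hi
    have h := congrArg (Nat.cast : ℕ → ZMod 3) (cnt_neg_one I)
    rw [hI] at h
    push_cast at h
    rw [zero_sub, cnt_zero, h]
    rfl
  · rw [cnt_pred hn I hi]
    push_cast
    rfl

lemma exists_peaks (hn : 1 < n) {I : Finset (ZMod n)} (hI : I.card = 3) :
    ∃ a : ZMod 3 → ZMod n, (∀ l, a l ∈ I) ∧ (∀ l, cls I (a l) = l) ∧
      ∀ i ∈ I, a (cls I i) = i := by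
  have hne : I.Nonempty := Finset.card_pos.mp (by omega)
  have hex : ∀ i, ∃ b ∈ I, cls I b = cls I i := by
    refine cyclic_induction_back hne (fun i hi => ⟨i, hi, rfl⟩) ?_
    rintro i hi ⟨b, hb, h⟩
    exact ⟨b, hb, by rw [h, cls_pred hn hI i, if_neg hi, add_zero]⟩
  have hall : ∀ l, ∃ b ∈ I, cls I b = l := by
    obtain ⟨b, hb⟩ := hne
    have h1 : ∀ l, (∃ b ∈ I, cls I b = l) → ∃ b ∈ I, cls I b = l - 1 := by
      rintro _ ⟨b, hb, rfl⟩
      obtain ⟨b', hb', h⟩ := hex (b - 1)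
      exact ⟨b', hb', by rw [h, cls_pred hn hI b, if_pos hb, add_sub_cancel_right]⟩
    have h0 := fun m : ℕ => show ∃ b' ∈ I, cls I b' = cls I b - m by
      induction m with
      | zero => exact ⟨b, hb, by simp⟩
      | succ m ih =>
        obtain ⟨b', hb', h⟩ := h1 _ ih
        exact ⟨b', hb', by rw [h]; push_cast; ring⟩
    intro l
    simpa using h0 (cls I b - l).val
  choose a ha hal using hall
  refine ⟨a, ha, hal, fun i hi => ?_⟩
  have hinj : Function.Injective a := fun x y h => by rw [← hal x, ← hal y, h]
  have himg : Finset.univ.image a = I := by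
    refine Finset.eq_of_subset_of_card_le (fun x hx => ?_) ?_
    · obtain ⟨l, _, rfl⟩ := Finset.mem_image.mp hx
      exact ha l
    · rw [Finset.card_image_of_injective _ hinj, hI]
      simp
  rw [← himg] at hi
  obtain ⟨l, _, rfl⟩ := Finset.mem_image.mp hi
  rw [hal]

end Cyclic

section Frames

/-- The field of fractions of `ℂ⟦t⟧`. -/
abbrev Kser : Type := FractionRing Rser

/-- The inclusion of `ℂ⟦t⟧` into its field of fractions. -/
abbrev toK : Rser →+* Kser := algebraMap Rser Kser

lemma toK_injective : Function.Injective toK := IsFractionRing.injective Rser Kser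

lemma tser_ne_zero : tser ≠ 0 := PowerSeries.X_ne_zero

lemma toK_tser_ne_zero : toK tser ≠ 0 :=
  (map_ne_zero_iff _ toK_injective).mpr tser_ne_zero

lemma map_toK_injective {m p : Type*} :
    Function.Injective fun A : Matrix m p Rser => A.map toK :=
  Matrix.map_injective toK_injective

variable {k n s s' : ℕ}

/-- The action of `x` on the rank one module `L_I`. -/
def xe (I : Finset (ZMod n)) (i : ZMod n) : Rser := if i ∈ I then 1 else tser

/-- The action of `y` on the rank one module `L_I`. -/
def ye (I : Finset (ZMod n)) (i : ZMod n) : Rser := if i ∈ I then tser else 1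

lemma xe_mul_ye (I : Finset (ZMod n)) (i : ZMod n) : xe I i * ye I i = tser := by
  unfold xe ye; split_ifs <;> simp

lemma toK_xe_ne_zero (I : Finset (ZMod n)) (i : ZMod n) : toK (xe I i) ≠ 0 := by
  unfold xe; split_ifs
  · simp
  · exact toK_tser_ne_zero

lemma toK_ye_ne_zero (I : Finset (ZMod n)) (i : ZMod n) : toK (ye I i) ≠ 0 := by
  unfold ye; split_ifs
  · exact toK_tser_ne_zero
  · simp

lemma map_smul_one (r : Rser) :
    (r • (1 : Matrix (Fin s) (Fin s) Rser)).map toK = toK r • 1 := by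
  ext i j
  by_cases h : i = j <;> simp [h]

/-- A frame of `M` relative to `I`: an embedding of `M` into a sum of copies of `L_I`, over the
field of fractions. -/
structure IsFrame (I : Finset (ZMod n)) (M : CMMod k n s)
    (g : ZMod n → Matrix (Fin s) (Fin s) Kser) : Prop where
  isUnit : ∀ i, IsUnit (g i)
  mulX : ∀ i, g i * (M.X i).map toK = toK (xe I i) • g (i - 1)

variable {I : Finset (ZMod n)} {M : CMMod k n s} {M' : CMMod k n s'}
  {g : ZMod n → Matrix (Fin s) (Fin s) Kser} {g' : ZMod n → Matrix (Fin s') (Fin s') Kser}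

lemma IsFrame.mulY (h : IsFrame I M g) (i : ZMod n) :
    g (i - 1) * (M.Y i).map toK = toK (ye I i) • g i := by
  refine smul_right_injective _ (toK_xe_ne_zero I i) ?_
  dsimp only
  rw [← Matrix.smul_mul, ← h.mulX, Matrix.mul_assoc, ← Matrix.map_mul, M.hXY, map_smul_one,
    smul_smul, ← map_mul, xe_mul_ye, Matrix.mul_smul, Matrix.mul_one]

lemma IsFrame.of_mulY (hu : ∀ i, IsUnit (g i))
    (h : ∀ i, g (i - 1) * (M.Y i).map toK = toK (ye I i) • g i) : IsFrame I M g := by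
  refine ⟨hu, fun i => smul_right_injective _ (toK_ye_ne_zero I i) ?_⟩
  dsimp only
  rw [← Matrix.smul_mul, ← h, Matrix.mul_assoc, ← Matrix.map_mul, M.hYX, map_smul_one,
    smul_smul, ← map_mul, mul_comm, xe_mul_ye, Matrix.mul_smul, Matrix.mul_one]

lemma mul_left_cancel_of_isUnit {A : Matrix (Fin s) (Fin s) Kser} (hA : IsUnit A)
    {B C : Matrix (Fin s) (Fin s') Kser} (h : A * B = A * C) : B = C := by
  have hA' := (Matrix.isUnit_iff_isUnit_det A).mp hA
  rw [← Matrix.nonsing_inv_mul_cancel_left A B hA', h, Matrix.nonsing_inv_mul_cancel_left A C hA']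

lemma mul_right_cancel_of_isUnit {A : Matrix (Fin s) (Fin s) Kser} (hA : IsUnit A)
    {B C : Matrix (Fin s') (Fin s) Kser} (h : B * A = C * A) : B = C := by
  have hA' := (Matrix.isUnit_iff_isUnit_det A).mp hA
  rw [← Matrix.mul_nonsing_inv_cancel_right A B hA', h, Matrix.mul_nonsing_inv_cancel_right A C hA']

/-- In terms of frames a morphism is multiplication by a constant matrix. -/
lemma CMHom.exists_const [NeZero n] (h : IsFrame I M g) (h' : IsFrame I M' g') (f : CMHom M M') :
    ∃ C : Matrix (Fin s') (Fin s) Kser, ∀ i, g' i * (f.F i).map toK = C * g i := by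
  have hg := fun i => (Matrix.isUnit_iff_isUnit_det _).mp (h.isUnit i)
  let C : ZMod n → Matrix (Fin s') (Fin s) Kser := fun i => g' i * (f.F i).map toK * (g i)⁻¹
  have hC : ∀ i, g' i * (f.F i).map toK = C i * g i := fun i =>
    (Matrix.nonsing_inv_mul_cancel_right _ _ (hg i)).symm
  refine ⟨C 0, fun i => ?_⟩
  rw [hC, eq_of_eq_pred (C := C) (fun i => ?_) i 0]
  refine mul_right_cancel_of_isUnit (h.isUnit (i - 1)) ?_
  refine smul_right_injective _ (toK_xe_ne_zero I i) ?_
  dsimp only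
  rw [← Matrix.mul_smul, ← h.mulX, ← Matrix.mul_assoc, ← hC, Matrix.mul_assoc, ← Matrix.map_mul,
    f.hX, Matrix.map_mul, ← Matrix.mul_assoc, h'.mulX, Matrix.smul_mul, hC]

/-- A constant matrix which is integral with respect to the frames is a morphism. -/
def CMHom.ofConst (h : IsFrame I M g) (h' : IsFrame I M' g') (C : Matrix (Fin s') (Fin s) Kser)
    (F : ZMod n → Matrix (Fin s') (Fin s) Rser) (hF : ∀ i, g' i * (F i).map toK = C * g i) :
    CMHom M M' where
  F := F
  hX i := map_toK_injective <| mul_left_cancel_of_isUnit (h'.isUnit i) <| by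
    dsimp only
    rw [Matrix.map_mul, Matrix.map_mul, ← Matrix.mul_assoc, ← Matrix.mul_assoc, hF, h'.mulX,
      Matrix.smul_mul, hF, Matrix.mul_assoc, h.mulX, Matrix.mul_smul]
  hY i := map_toK_injective <| mul_left_cancel_of_isUnit (h'.isUnit (i - 1)) <| by
    dsimp only
    rw [Matrix.map_mul, Matrix.map_mul, ← Matrix.mul_assoc, ← Matrix.mul_assoc, hF, h'.mulY,
      Matrix.smul_mul, hF, Matrix.mul_assoc, h.mulY, Matrix.mul_smul]

/-- The product `X_m ⋯ X_1`. -/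
def xProd (X : ZMod n → Matrix (Fin s) (Fin s) Rser) : ℕ → Matrix (Fin s) (Fin s) Rser
  | 0 => 1
  | m + 1 => X (m + 1 : ℕ) * xProd X m

/-- The product `Y_1 ⋯ Y_m`. -/
def yProd (Y : ZMod n → Matrix (Fin s) (Fin s) Rser) : ℕ → Matrix (Fin s) (Fin s) Rser
  | 0 => 1
  | m + 1 => yProd Y m * Y (m + 1 : ℕ)

lemma xProd_mul_yProd (M : CMMod k n s) (m : ℕ) :
    xProd M.X m * yProd M.Y m = tser ^ m • (1 : Matrix (Fin s) (Fin s) Rser) := by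
  induction m with
  | zero => simp [xProd, yProd]
  | succ m ih =>
    rw [xProd, yProd, Matrix.mul_assoc, ← Matrix.mul_assoc (xProd M.X m), ih, Matrix.smul_mul,
      Matrix.one_mul, Matrix.mul_smul, M.hXY, smul_smul, pow_succ]

lemma cycProd_eq (X : ZMod n → Matrix (Fin s) (Fin s) Rser) (i : ZMod n) :
    cycProd X i = ((List.range n).map fun j : ℕ => X (i - (j : ZMod n))).prod := by
  unfold cycProd
  simp [← List.map_eq_flatMap, Function.comp_def]

lemma xProd_eq (X : ZMod n → Matrix (Fin s) (Fin s) Rser) (m : ℕ) :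
    ((List.range m).map fun j : ℕ => X ((m : ZMod n) - (j : ZMod n))).prod = xProd X m := by
  induction m with
  | zero => simp [xProd]
  | succ m ih =>
    rw [List.range_succ_eq_map, List.map_cons, List.prod_cons, List.map_map, xProd, ← ih]
    congr 2
    · simp
    · refine List.map_congr_left fun j _ => ?_
      simp

lemma yProd_self (M : CMMod 3 n s) (hn : 3 ≤ n) :
    yProd M.Y n = tser ^ 3 • (1 : Matrix (Fin s) (Fin s) Rser) := by
  have h1 := M.hcyc 0
  have h2 := xProd_eq M.X n
  rw [CharP.cast_eq_zero] at h2
  rw [cycProd_eq, h2] at h1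
  have h3 := xProd_mul_yProd M n
  rw [h1, Matrix.smul_mul, Matrix.one_mul] at h3
  have h4 : tser ^ n = tser ^ (n - 3) * tser ^ 3 := by rw [← pow_add]; congr 1; omega
  rw [h4, mul_smul] at h3
  exact smul_right_injective _ (pow_ne_zero _ tser_ne_zero) h3

lemma exists_isFrame [NeZero n] (hn : 3 ≤ n) (hI : I.card = 3) (M : CMMod 3 n s) :
    ∃ g, IsFrame I M g := by
  refine ⟨fun i => ((toK tser) ^ cnt I i)⁻¹ • (yProd M.Y i.val).map toK,
    IsFrame.of_mulY (fun i => ?_) fun i => ?_⟩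
  · have h := congrArg (fun A => A.map toK) (xProd_mul_yProd M i.val)
    rw [Matrix.map_mul, map_smul_one] at h
    have hne : toK (tser ^ i.val) ≠ 0 := by
      rw [map_pow]; exact pow_ne_zero _ toK_tser_ne_zero
    have hne' : (toK tser ^ cnt I i) ≠ 0 := pow_ne_zero _ toK_tser_ne_zero
    refine IsUnit.of_mul_eq_one_right
      ((toK tser ^ cnt I i * (toK (tser ^ i.val))⁻¹) • (xProd M.X i.val).map toK) ?_
    rw [Matrix.smul_mul, Matrix.mul_smul, h, smul_smul, smul_smul]
    convert one_smul Kser _ using 2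
    field_simp
  · by_cases hi : i = 0
    · subst hi
      have h3 := cnt_neg_one I
      have h4 := val_neg_one_add_one (n := n)
      have h5 := yProd_self M hn
      have h7 : yProd M.Y ((-1 : ZMod n).val + 1) = yProd M.Y n := by rw [h4]
      rw [yProd, h4, CharP.cast_eq_zero, h5] at h7
      rw [zero_sub, Matrix.smul_mul, ← Matrix.map_mul, h7, map_smul_one, cnt_zero, ZMod.val_zero,
        yProd, smul_smul, ye]
      rw [hI] at h3
      have ht := toK_tser_ne_zero
      rw [← h3, map_pow, pow_add]
      split_ifs with h <;> simp [ht]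
    · have hv := val_pred (by omega) hi
      rw [cnt_pred (by omega) I hi, ← hv, yProd, hv, Matrix.smul_mul, ← Matrix.map_mul,
        ZMod.natCast_zmod_val, smul_smul]
      congr 1
      have ht := toK_tser_ne_zero
      unfold ye
      split_ifs with h
      · field_simp
        ring
      · simp

end Frames

section Constructions

variable {k n s r s' : ℕ} {I : Finset (ZMod n)}

lemma prod_range_sub [NeZero n] {α : Type*} [CommMonoid α] (f : ZMod n → α) (i : ZMod n) :
    ∏ j ∈ Finset.range n, f (i - (j : ZMod n)) = ∏ j, f j := by
  refine Finset.prod_bij' (fun j _ => i - (j : ZMod n)) (fun x _ => (i - x).val)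
    (fun _ _ => Finset.mem_univ _) (fun x _ => Finset.mem_range.mpr (ZMod.val_lt _))
    (fun j hj => ?_) (fun x _ => ?_) (fun _ _ => rfl)
  · rw [sub_sub_cancel, ZMod.val_cast_of_lt (Finset.mem_range.mp hj)]
  · rw [ZMod.natCast_zmod_val, sub_sub_cancel]

lemma prod_xe [NeZero n] (I : Finset (ZMod n)) : ∏ j, xe I j = tser ^ (n - I.card) := by
  unfold xe
  rw [Finset.prod_ite, Finset.prod_const_one, one_mul, Finset.prod_const]
  congr 1
  have := Finset.card_compl I
  rw [ZMod.card] at this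
  rw [← this]
  congr 1
  ext j
  simp

lemma cycProd_of_frame [NeZero n] {X : ZMod n → Matrix (Fin s) (Fin s) Rser}
    {g : ZMod n → Matrix (Fin s) (Fin s) Kser} (hu : ∀ i, IsUnit (g i))
    (h : ∀ i, g i * (X i).map toK = toK (xe I i) • g (i - 1)) (i : ZMod n) :
    cycProd X i = tser ^ (n - I.card) • (1 : Matrix (Fin s) (Fin s) Rser) := by
  have key : ∀ m : ℕ, g i * (((List.range m).map fun j : ℕ => X (i - (j : ZMod n))).prod).map toK =
      toK (∏ j ∈ Finset.range m, xe I (i - (j : ZMod n))) • g (i - m) := by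
    intro m
    induction m with
    | zero => simp [Matrix.map_one]
    | succ m ih =>
      rw [List.range_succ, List.map_append, List.prod_append, List.map_singleton,
        List.prod_singleton, Matrix.map_mul, ← Matrix.mul_assoc, ih, Matrix.smul_mul, h, smul_smul,
        Finset.prod_range_succ, map_mul, Nat.cast_succ, sub_sub]
  have := key n
  rw [← cycProd_eq, prod_range_sub, prod_xe, CharP.cast_eq_zero, sub_zero] at this
  refine map_toK_injective (mul_left_cancel_of_isUnit (hu i) ?_)
  dsimp only
  rw [this, map_smul_one, Matrix.mul_smul, Matrix.mul_one]

/-- The rank one module `L_J`. -/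
def rankOne [NeZero n] (J : Finset (ZMod n)) (hJ : J.card = 3) : CMMod 3 n 1 where
  X i := xe J i • 1
  Y i := ye J i • 1
  hXY i := by rw [Matrix.smul_mul, Matrix.one_mul, smul_smul, xe_mul_ye]
  hYX i := by rw [Matrix.smul_mul, Matrix.one_mul, smul_smul, mul_comm, xe_mul_ye]
  hcyc i := by
    rw [← hJ]
    refine cycProd_of_frame (g := fun _ => 1) (fun _ => isUnit_one) (fun i => ?_) i
    rw [Matrix.one_mul, map_smul_one]

lemma isRankOne_rankOne [NeZero n] (J : Finset (ZMod n)) (hJ : J.card = 3) :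
    IsRankOne J (rankOne J hJ) := by
  constructor <;> intro i <;> simp only [rankOne, xe, ye] <;> split_ifs <;> simp

lemma isFrame_rankOne [NeZero n] (J : Finset (ZMod n)) (hJ : J.card = 3) :
    IsFrame J (rankOne J hJ) fun _ => 1 :=
  ⟨fun _ => isUnit_one, fun i => by rw [Matrix.one_mul]; exact map_smul_one _⟩

/-- The submodule of `M` spanned at each vertex by the columns of the constant matrix `J`. -/
def CMMod.sub (M : CMMod k n s) (J : Matrix (Fin s) (Fin r) Rser) (J' : Matrix (Fin r) (Fin s) Rser)
    (hJ : J' * J = 1) (X Y : ZMod n → Matrix (Fin r) (Fin r) Rser)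
    (hX : ∀ i, M.X i * J = J * X i) (hY : ∀ i, M.Y i * J = J * Y i) : CMMod k n r :=
  have cancel : ∀ {B C : Matrix (Fin r) (Fin r) Rser}, J * B = J * C → B = C := fun {B C} h => by
    rw [← Matrix.one_mul B, ← hJ, Matrix.mul_assoc, h, ← Matrix.mul_assoc, hJ, Matrix.one_mul]
  { X := X
    Y := Y
    hXY := fun i => cancel <| by
      rw [← Matrix.mul_assoc, ← hX, Matrix.mul_assoc, ← hY, ← Matrix.mul_assoc, M.hXY,
        Matrix.smul_mul, Matrix.mul_smul, Matrix.one_mul, Matrix.mul_one]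
    hYX := fun i => cancel <| by
      rw [← Matrix.mul_assoc, ← hY, Matrix.mul_assoc, ← hX, ← Matrix.mul_assoc, M.hYX,
        Matrix.smul_mul, Matrix.mul_smul, Matrix.one_mul, Matrix.mul_one]
    hcyc := fun i => cancel <| by
      have key : ∀ l : List ℕ, (l.map fun j : ℕ => M.X (i - (j : ZMod n))).prod * J =
          J * (l.map fun j : ℕ => X (i - (j : ZMod n))).prod := by
        intro l
        induction l with
        | nil => simp
        | cons a l ih =>
          simp only [List.map_cons, List.prod_cons]
          rw [Matrix.mul_assoc, ih, ← Matrix.mul_assoc, hX, Matrix.mul_assoc]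
      rw [cycProd_eq, ← key, ← cycProd_eq, M.hcyc, Matrix.smul_mul, Matrix.mul_smul,
        Matrix.one_mul, Matrix.mul_one] }

/-- A short exact sequence whose maps are given by constant matrices, split over `ℂ⟦t⟧`. -/
def CMses.ofConst {sA sE sB : ℕ} {A : CMMod k n sA} {E : CMMod k n sE} {B : CMMod k n sB}
    (J : Matrix (Fin sE) (Fin sA) Rser) (J' : Matrix (Fin sA) (Fin sE) Rser)
    (P : Matrix (Fin sB) (Fin sE) Rser) (P' : Matrix (Fin sE) (Fin sB) Rser)
    (hJ : J' * J = 1) (hP : P * P' = 1) (hPJ : P * J = 0) (hone : J * J' + P' * P = 1)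
    (hJX : ∀ i, J * A.X i = E.X i * J) (hJY : ∀ i, J * A.Y i = E.Y i * J)
    (hPX : ∀ i, P * E.X i = B.X i * P) (hPY : ∀ i, P * E.Y i = B.Y i * P) : CMses A E B where
  emb := ⟨fun _ => J, hJX, hJY⟩
  quo := ⟨fun _ => P, hPX, hPY⟩
  inj _ := Function.LeftInverse.injective (g := J'.mulVecLin) fun v => by
    simp [Matrix.mulVec_mulVec, hJ]
  surj _ := Function.RightInverse.surjective (g := P'.mulVecLin) fun v => by
    simp [Matrix.mulVec_mulVec, hP]
  exactness _ := by
    ext v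
    simp only [LinearMap.mem_range, LinearMap.mem_ker, Matrix.mulVecLin_apply]
    constructor
    · rintro ⟨w, rfl⟩
      simp [Matrix.mulVec_mulVec, hPJ]
    · intro hv
      refine ⟨J'.mulVec v, ?_⟩
      have h := congrArg (fun A => A.mulVec v) hone
      simpa [Matrix.add_mulVec, ← Matrix.mulVec_mulVec, hv] using h

end Constructions

section ThreePeaks

/-- A primitive cube root of unity. -/
def om : ℂ := Complex.exp (2 * Real.pi * Complex.I / 3)

lemma om_primitive : IsPrimitiveRoot om 3 := Complex.isPrimitiveRoot_exp 3 (by norm_num)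

lemma om_pow_three : om ^ 3 = 1 := om_primitive.pow_eq_one

lemma om_sum : 1 + om + om ^ 2 = 0 := by
  have := om_primitive.geom_sum_eq_zero (by norm_num)
  simpa [Finset.sum_range_succ] using this

/-- The cube roots of unity in `ℂ⟦t⟧`, indexed by `ℤ/3`. -/
def cub (l : ZMod 3) : Rser := PowerSeries.C (om ^ l.val)

lemma cub_pow_three (l : ZMod 3) : cub l ^ 3 = 1 := by
  rw [cub, ← map_pow, ← pow_mul, mul_comm, pow_mul, om_pow_three, one_pow, map_one]

variable {n : ℕ} {I : Finset (ZMod n)}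

lemma mem_image_sub {d i : ZMod n} : i ∈ I.image (· - d) ↔ i + d ∈ I := by
  simp only [Finset.mem_image]
  constructor
  · rintro ⟨a, ha, rfl⟩; simpa using ha
  · intro h; exact ⟨_, h, by ring⟩

lemma card_image_sub {d : ZMod n} : (I.image (· - d)).card = I.card :=
  Finset.card_image_of_injective _ (sub_left_injective)

/-- The upper triangular entry of the middle term in the column of `L_I`. -/
def entU (I : Finset (ZMod n)) (i : ZMod n) : Rser :=
  if i ∈ I then -cub (cls I i) ^ 2 else if i + 1 ∈ I then cub (cls I (i + 1)) ^ 2 else 0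

/-- The upper triangular entry of the middle term in the column of `L_X`. -/
def entV (I : Finset (ZMod n)) (i : ZMod n) : Rser :=
  if i + 2 ∈ I then -cub (cls I i) else if i + 1 ∈ I then cub (cls I (i + 1)) else 0

/-- The action of `x` on the middle term. -/
def midX (I : Finset (ZMod n)) (i : ZMod n) : Matrix (Fin 3) (Fin 3) Rser :=
  !![xe (I.image (· - 1)) i, entU I i, entV I i; 0, xe I i, 0; 0, 0, xe (I.image (· - 2)) i]

/-- The action of `y` on the middle term. -/
def midY (I : Finset (ZMod n)) (i : ZMod n) : Matrix (Fin 3) (Fin 3) Rser :=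
  !![ye (I.image (· - 1)) i, -entU I i, -entV I i; 0, ye I i, 0; 0, 0, ye (I.image (· - 2)) i]

/-- The frame of the middle term. -/
def midG (I : Finset (ZMod n)) (i : ZMod n) : Matrix (Fin 3) (Fin 3) Kser :=
  if i + 1 ∈ I then
    !![toK tser, -toK (cub (cls I (i + 1))) ^ 2, -toK (cub (cls I (i + 1))); 0, 1, 0; 0, 0, 1]
  else if i + 2 ∈ I then 1
  else !![1, 0, -toK (cub (cls I i)) * (toK tser)⁻¹; 0, 1, 0; 0, 0, (toK tser)⁻¹]

/-- The frame of the left-hand term. -/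
def leftG (I : Finset (ZMod n)) (i : ZMod n) : Matrix (Fin 2) (Fin 2) Kser :=
  if i + 1 ∈ I then !![toK tser, -toK (cub (cls I (i + 1))); 0, 1]
  else if i + 2 ∈ I then 1
  else !![1, -toK (cub (cls I i)) * (toK tser)⁻¹; 0, (toK tser)⁻¹]

lemma add_two_notMem (hpeaks : ∀ i ∈ I, i + 1 ∉ I) {i : ZMod n} (h : i + 1 ∈ I) : i + 2 ∉ I := by
  have := hpeaks _ h
  rwa [add_assoc, one_add_one_eq_two] at this

lemma isUnit_midG (i : ZMod n) : IsUnit (midG I i) := by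
  have ht := toK_tser_ne_zero
  rw [Matrix.isUnit_iff_isUnit_det, isUnit_iff_ne_zero]
  unfold midG
  split_ifs <;> simp [Matrix.det_fin_three, ht]

lemma isUnit_leftG (i : ZMod n) : IsUnit (leftG I i) := by
  have ht := toK_tser_ne_zero
  rw [Matrix.isUnit_iff_isUnit_det, isUnit_iff_ne_zero]
  unfold leftG
  split_ifs <;> simp [Matrix.det_fin_two, ht]

lemma midX_mul_midY (hpeaks : ∀ i ∈ I, i + 1 ∉ I) (i : ZMod n) :
    midX I i * midY I i = tser • 1 := by
  have h1 := hpeaks i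
  have h2 := add_two_notMem hpeaks (i := i)
  simp only [midX, midY, entU, entV, xe, ye, mem_image_sub]
  split_ifs <;> first | tauto | skip
  all_goals
    ext a b : 1
    fin_cases a <;> fin_cases b <;> simp [Matrix.mul_apply, Fin.sum_univ_three] <;> ring

lemma midY_mul_midX (hpeaks : ∀ i ∈ I, i + 1 ∉ I) (i : ZMod n) :
    midY I i * midX I i = tser • 1 := by
  have h1 := hpeaks i
  have h2 := add_two_notMem hpeaks (i := i)
  simp only [midX, midY, entU, entV, xe, ye, mem_image_sub]
  split_ifs <;> first | tauto | skip
  all_goals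
    ext a b : 1
    fin_cases a <;> fin_cases b <;> simp [Matrix.mul_apply, Fin.sum_univ_three] <;> ring

lemma midG_mul_midX [NeZero n] (hn : 1 < n) (hI : I.card = 3)
    (hpeaks : ∀ i ∈ I, i + 1 ∉ I) (i : ZMod n) :
    midG I i * (midX I i).map toK = toK (xe I i) • midG I (i - 1) := by
  have h1 := hpeaks i
  have h2 := add_two_notMem hpeaks (i := i)
  have h3 := cls_pred hn hI i
  have h4 : i - 1 + 2 = i + 1 := by ring
  have ht := toK_tser_ne_zero
  simp only [midX, midG, entU, entV, xe, mem_image_sub, sub_add_cancel, h4]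
  split_ifs at h3 ⊢ <;> first | tauto | skip
  all_goals
    try rw [add_zero] at h3
    ext a b : 1
    fin_cases a <;> fin_cases b <;>
      simp [Matrix.mul_apply, Fin.sum_univ_three, ht, h3] <;>
      first | ring1 | field_simp

lemma leftG_mul_midX [NeZero n] (hn : 1 < n) (hI : I.card = 3)
    (hpeaks : ∀ i ∈ I, i + 1 ∉ I) (i : ZMod n) :
    leftG I i * (!![xe (I.image (· - 1)) i, entV I i; 0, xe (I.image (· - 2)) i]).map toK =
      toK (xe I i) • leftG I (i - 1) := by
  have h1 := hpeaks i
  have h2 := add_two_notMem hpeaks (i := i)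
  have h3 := cls_pred hn hI i
  have h4 : i - 1 + 2 = i + 1 := by ring
  have ht := toK_tser_ne_zero
  simp only [leftG, entV, xe, mem_image_sub, sub_add_cancel, h4]
  split_ifs at h3 ⊢ <;> first | tauto | skip
  all_goals
    try rw [add_zero] at h3
    ext a b : 1
    fin_cases a <;> fin_cases b <;>
      simp [Matrix.mul_apply, Fin.sum_univ_two, ht, h3] <;>
      first | ring1 | field_simp

end ThreePeaks

section Middle

variable {n : ℕ} [NeZero n] {I : Finset (ZMod n)}

/-- The middle term of the almost split sequence ending in `L_I`. -/
def midMod (hn : 1 < n) (hI : I.card = 3) (hpeaks : ∀ i ∈ I, i + 1 ∉ I) : CMMod 3 n 3 where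
  X := midX I
  Y := midY I
  hXY := midX_mul_midY hpeaks
  hYX := midY_mul_midX hpeaks
  hcyc i := by
    have h := cycProd_of_frame isUnit_midG (midG_mul_midX hn hI hpeaks) i
    rwa [hI] at h

variable (hn : 1 < n) (hI : I.card = 3) (hpeaks : ∀ i ∈ I, i + 1 ∉ I)

lemma isFrame_midMod : IsFrame I (midMod hn hI hpeaks) (midG I) :=
  ⟨isUnit_midG, midG_mul_midX hn hI hpeaks⟩

/-- The left-hand term of the almost split sequence ending in `L_I`, an extension of `L_X` by
`L_Y`. -/
def leftMod : CMMod 3 n 2 :=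
  (midMod hn hI hpeaks).sub !![1, 0; 0, 0; 0, 1] !![1, 0, 0; 0, 0, 1]
    (by ext i j : 1; fin_cases i <;> fin_cases j <;> simp [Matrix.mul_apply, Fin.sum_univ_three])
    (fun i => !![xe (I.image (· - 1)) i, entV I i; 0, xe (I.image (· - 2)) i])
    (fun i => !![ye (I.image (· - 1)) i, -entV I i; 0, ye (I.image (· - 2)) i])
    (fun i => by simp [midMod, midX])
    (fun i => by simp [midMod, midY])

lemma isFrame_leftMod : IsFrame I (leftMod hn hI hpeaks) (leftG I) :=
  ⟨isUnit_leftG, leftG_mul_midX hn hI hpeaks⟩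

/-- The kernel of the projection of the middle term onto `L_X`, an extension of `L_I` by `L_Y`. -/
def kerMod : CMMod 3 n 2 :=
  (midMod hn hI hpeaks).sub !![1, 0; 0, 1; 0, 0] !![1, 0, 0; 0, 1, 0]
    (by ext i j : 1; fin_cases i <;> fin_cases j <;> simp [Matrix.mul_apply, Fin.sum_univ_three])
    (fun i => !![xe (I.image (· - 1)) i, entU I i; 0, xe I i])
    (fun i => !![ye (I.image (· - 1)) i, -entU I i; 0, ye I i])
    (fun i => by simp [midMod, midX])
    (fun i => by simp [midMod, midY])

/-- The almost split sequence ending in `L_I`. -/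
def midSeq : CMses (leftMod hn hI hpeaks) (midMod hn hI hpeaks) (rankOne I hI) :=
  CMses.ofConst !![1, 0; 0, 0; 0, 1] !![1, 0, 0; 0, 0, 1] !![0, 1, 0] !![0; 1; 0]
    (by simp [Matrix.one_fin_two])
    (by simp [← Matrix.ext_iff])
    (by simp [← Matrix.ext_iff])
    (by simp [Matrix.one_fin_three])
    (fun i => by simp [leftMod, CMMod.sub, midMod, midX, funext_iff])
    (fun i => by simp [leftMod, CMMod.sub, midMod, midY, funext_iff])
    (fun i => by simp [rankOne, midMod, midX])
    (fun i => by simp [rankOne, midMod, midY])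

lemma hasFiltration_leftMod :
    HasFiltration (leftMod hn hI hpeaks) [I.image (· - 2), I.image (· - 1)] := by
  refine .step (isRankOne_rankOne _ (card_image_sub.trans hI))
    (.base (isRankOne_rankOne _ (card_image_sub.trans hI)))
    ⟨CMses.ofConst !![1; 0] !![1, 0] !![0, 1] !![0; 1] ?_ ?_ ?_ ?_ (fun i => ?_) (fun i => ?_)
      (fun i => ?_) (fun i => ?_)⟩
  all_goals simp [leftMod, CMMod.sub, rankOne, ← Matrix.ext_iff, Fin.forall_fin_succ]

lemma hasFiltration_kerMod : HasFiltration (kerMod hn hI hpeaks) [I, I.image (· - 1)] := by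
  refine .step (isRankOne_rankOne _ hI)
    (.base (isRankOne_rankOne _ (card_image_sub.trans hI)))
    ⟨CMses.ofConst !![1; 0] !![1, 0] !![0, 1] !![0; 1] ?_ ?_ ?_ ?_ (fun i => ?_) (fun i => ?_)
      (fun i => ?_) (fun i => ?_)⟩
  all_goals simp [kerMod, CMMod.sub, rankOne, ← Matrix.ext_iff, Fin.forall_fin_succ]

lemma hasFiltration_midMod :
    HasFiltration (midMod hn hI hpeaks) [I.image (· - 2), I, I.image (· - 1)] := by
  refine .step (isRankOne_rankOne _ (card_image_sub.trans hI)) (hasFiltration_kerMod hn hI hpeaks)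
    ⟨CMses.ofConst !![1, 0; 0, 1; 0, 0] !![1, 0, 0; 0, 1, 0] !![0, 0, 1] !![0; 0; 1] ?_ ?_ ?_ ?_
      (fun i => ?_) (fun i => ?_) (fun i => ?_) (fun i => ?_)⟩
  all_goals simp [midMod, midX, midY, kerMod, CMMod.sub, rankOne, ← Matrix.ext_iff,
    Fin.forall_fin_succ, funext_iff]

end Middle

section Cubic

lemma tser_dvd_iff {x : Rser} : tser ∣ x ↔ PowerSeries.constantCoeff x = 0 :=
  PowerSeries.X_dvd_iff

lemma isUnit_three : IsUnit (3 : Rser) := by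
  have h : (3 : Rser) = PowerSeries.C (3 : ℂ) := (map_ofNat PowerSeries.C 3).symm
  rw [h]
  exact (isUnit_iff_ne_zero.mpr (by norm_num)).map _

lemma cub_zero : cub 0 = 1 := by simp [cub]

lemma cub_two : cub 2 = cub 1 ^ 2 := by
  have h1 : (1 : ZMod 3).val = 1 := rfl
  have h2 : (2 : ZMod 3).val = 2 := rfl
  simp [cub, h1, h2]

lemma one_add_cub : 1 + cub 1 + cub 1 ^ 2 = 0 := by
  have h1 : (1 : ZMod 3).val = 1 := rfl
  have h := congrArg (PowerSeries.C (R := ℂ)) om_sum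
  simpa [cub, h1] using h

/-- Divisibility of a quadratic polynomial at the three cube roots of unity forces divisibility of
its coefficients. -/
lemma tser_dvd_of_cub {x y z : Rser} (h : ∀ l, tser ∣ x + cub l * y + cub l ^ 2 * z) :
    tser ∣ x ∧ tser ∣ y ∧ tser ∣ z := by
  have h0 := h 0
  have h1 := h 1
  have h2 := h 2
  rw [cub_zero] at h0
  rw [cub_two] at h2
  have hs := one_add_cub
  refine ⟨(isUnit_three.dvd_mul_left).mp ?_, (isUnit_three.dvd_mul_left).mp ?_,
    (isUnit_three.dvd_mul_left).mp ?_⟩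
  · convert (h0.add h1).add h2 using 1
    linear_combination (-y - z * (cub 1 ^ 2 - cub 1 + 1)) * hs
  · convert (h0.add (h1.mul_left (cub 1 ^ 2))).add (h2.mul_left (cub 1)) using 1
    linear_combination (-x - 2 * y * (cub 1 - 1) - z * (cub 1 ^ 3 - cub 1 + 1)) * hs
  · convert (h0.add (h1.mul_left (cub 1))).add (h2.mul_left (cub 1 ^ 2)) using 1
    linear_combination
      (-x - y * (cub 1 ^ 2 - cub 1 + 1) - z * (cub 1 - 1) * (cub 1 ^ 3 + 2)) * hs

lemma eq_zero_of_mul_self {s : ℕ} {E : Matrix (Fin s) (Fin s) Rser} (h : E * E = E)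
    (h0 : ∀ i j, tser ∣ E i j) : E = 0 := by
  have h1 : E.map PowerSeries.constantCoeff = 0 := by
    ext i j
    exact tser_dvd_iff.mp (h0 i j)
  have h2 : IsUnit (1 - E).det := by
    rw [PowerSeries.isUnit_iff_constantCoeff, RingHom.map_det, map_sub, map_one,
      RingHom.mapMatrix_apply, h1, sub_zero, Matrix.det_one]
    exact isUnit_one
  have h3 : (1 - E) * E = 0 := by rw [Matrix.sub_mul, Matrix.one_mul, h, sub_self]
  rw [← Matrix.nonsing_inv_mul_cancel_left (1 - E) E h2, h3, Matrix.mul_zero]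

end Cubic

section Left

variable {n : ℕ} {I : Finset (ZMod n)}

lemma exists_leftG_eq_one (hI : I.card = 3) (hpeaks : ∀ i ∈ I, i + 1 ∉ I) :
    ∃ v, leftG I v = 1 ∧ midG I v = 1 := by
  obtain ⟨b, hb⟩ := Finset.card_pos.mp (by omega : 0 < I.card)
  have h1 : b - 2 + 1 ∉ I := fun h => hpeaks _ h (by convert hb using 1; ring)
  have h2 : b - 2 + 2 ∈ I := by rwa [sub_add_cancel]
  exact ⟨b - 2, by rw [leftG, if_neg h1, if_pos h2], by rw [midG, if_neg h1, if_pos h2]⟩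

variable [NeZero n]

lemma indecomposable_rankOne (hI : I.card = 3) : Indecomposable (rankOne I hI) := by
  intro f hf
  obtain ⟨C, hC⟩ := f.exists_const (isFrame_rankOne I hI) (isFrame_rankOne I hI)
  have hc : ∀ i, f.F i = f.F 0 := fun i => map_toK_injective <| by
    have h1 := hC i
    have h2 := hC 0
    rw [Matrix.one_mul] at h1 h2
    exact h1.trans h2.symm
  have h := congrFun (congrFun (hf 0) 0) 0
  rw [Matrix.mul_apply, Fin.sum_univ_one] at h
  rcases IsIdempotentElem.iff_eq_zero_or_one.mp h with h | h
  · left; intro i; rw [hc i]; ext a b : 1; rw [Subsingleton.elim a 0, Subsingleton.elim b 0, h]; rfl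
  · right; intro i; rw [hc i]; ext a b : 1; rw [Subsingleton.elim a 0, Subsingleton.elim b 0, h]; rfl

variable (hn : 1 < n) (hI : I.card = 3) (hpeaks : ∀ i ∈ I, i + 1 ∉ I)

lemma exists_peak_vertex (hn : 1 < n) (hI : I.card = 3) (l : ZMod 3) :
    ∃ i, leftG I i = !![toK tser, -toK (cub l); 0, 1] ∧
      midG I i = !![toK tser, -toK (cub l) ^ 2, -toK (cub l); 0, 1, 0; 0, 0, 1] := by
  obtain ⟨a, ha, ha', -⟩ := exists_peaks hn hI
  have h : a l - 1 + 1 ∈ I := by rw [sub_add_cancel]; exact ha l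
  refine ⟨a l - 1, ?_, ?_⟩
  · rw [leftG, if_pos h, sub_add_cancel, ha']
  · rw [midG, if_pos h, sub_add_cancel, ha']

lemma indecomposable_leftMod : Indecomposable (leftMod hn hI hpeaks) := by
  have hfr := isFrame_leftMod hn hI hpeaks
  intro f hf
  obtain ⟨C, hC⟩ := f.exists_const hfr hfr
  obtain ⟨v, hv, -⟩ := exists_leftG_eq_one hI hpeaks
  have hCv := hC v
  rw [hv, Matrix.one_mul, Matrix.mul_one] at hCv
  set D := f.F v with hD
  have hDD : D * D = D := hf v
  have hdvd : ∀ l, tser ∣ D 0 1 + cub l * (D 1 1 - D 0 0) + cub l ^ 2 * (-D 1 0) := by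
    intro l
    obtain ⟨i, hi, -⟩ := exists_peak_vertex hn hI l
    have h := hC i
    rw [hi, ← hCv] at h
    have h1 := congrFun (congrFun h 0) 1
    have h2 := congrFun (congrFun h 1) 1
    simp only [Matrix.mul_apply, Fin.sum_univ_two, Matrix.map_apply, Matrix.of_apply,
      Matrix.cons_val', Matrix.cons_val_zero, Matrix.cons_val_one, Matrix.cons_val_fin_one] at h1 h2
    refine ⟨f.F i 0 1, toK_injective ?_⟩
    simp only [map_add, map_mul, map_sub, map_pow, map_neg]
    linear_combination -h1 - toK (cub l) * h2
  obtain ⟨hq, hd, hr⟩ := tser_dvd_of_cub hdvd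
  rw [dvd_neg] at hr
  have key : D = 0 ∨ D = 1 := by
    have hp := congrArg PowerSeries.constantCoeff (congrFun (congrFun hDD 0) 0)
    rw [Matrix.mul_apply, Fin.sum_univ_two, map_add, map_mul, map_mul, tser_dvd_iff.mp hq,
      zero_mul, add_zero] at hp
    rcases IsIdempotentElem.iff_eq_zero_or_one.mp hp with hp | hp
    · left
      have hp' := tser_dvd_iff.mpr hp
      refine eq_zero_of_mul_self hDD fun i j => ?_
      fin_cases i <;> fin_cases j
      · exact hp'
      · exact hq
      · exact hr
      · exact (dvd_sub_left hp').mp hd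
    · right
      have hp' : tser ∣ 1 - D 0 0 := tser_dvd_iff.mpr (by rw [map_sub, map_one, hp, sub_self])
      refine (sub_eq_zero.mp (eq_zero_of_mul_self (E := 1 - D) ?_ fun i j => ?_)).symm
      · exact IsIdempotentElem.one_sub hDD
      fin_cases i <;> fin_cases j
      · exact hp'
      · simpa using hq
      · simpa using hr
      · have := hp'.sub hd
        simpa using this
  rcases key with h | h
  · left
    intro i
    refine map_toK_injective (mul_left_cancel_of_isUnit (hfr.isUnit i) ?_)
    dsimp only
    rw [hC, ← hCv, h]
    simp
  · right
    intro i
    refine map_toK_injective (mul_left_cancel_of_isUnit (hfr.isUnit i) ?_)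
    dsimp only
    rw [hC, ← hCv, h]
    simp [Matrix.map_one]

lemma not_splits_midSeq : ¬ (midSeq hn hI hpeaks).Splits := by
  rintro ⟨ρ, hρ⟩
  obtain ⟨C, hC⟩ := ρ.exists_const (isFrame_midMod hn hI hpeaks) (isFrame_leftMod hn hI hpeaks)
  obtain ⟨v, hv, hv'⟩ := exists_leftG_eq_one hI hpeaks
  have hCv := hC v
  rw [hv, hv', Matrix.one_mul, Matrix.mul_one] at hCv
  set D := ρ.F v with hD
  have hDJ : D * (!![1, 0; 0, 0; 0, 1] : Matrix _ _ Rser) = 1 := hρ v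
  have h00 := congrFun (congrFun hDJ 0) 0
  have h10 := congrFun (congrFun hDJ 1) 0
  simp [Matrix.mul_apply, Fin.sum_univ_three] at h00 h10
  have hdvd : ∀ l, tser ∣ D 0 1 + cub l * D 1 1 + cub l ^ 2 * (-1) := by
    intro l
    obtain ⟨i, hi, hi'⟩ := exists_peak_vertex hn hI l
    have h := hC i
    rw [hi, hi', ← hCv] at h
    have h1 := congrFun (congrFun h 0) 1
    have h2 := congrFun (congrFun h 1) 1
    simp [Matrix.mul_apply, Fin.sum_univ_two, Fin.sum_univ_three, h00, h10] at h1 h2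
    rw [h2] at h1
    refine ⟨ρ.F i 0 1, toK_injective ?_⟩
    simp only [map_add, map_mul, map_pow, map_neg, map_one]
    linear_combination -h1
  have h := (tser_dvd_of_cub hdvd).2.2
  rw [tser_dvd_iff] at h
  simp at h

end Left

section Lattices

variable {n s s' k : ℕ} {I : Finset (ZMod n)}

/-- The lattice spanned by the columns of a matrix. -/
def lat (g : Matrix (Fin s') (Fin s) Kser) : Submodule Rser (Fin s' → Kser) :=
  LinearMap.range ((g.mulVecLin.restrictScalars Rser).comp
    ((Algebra.linearMap Rser Kser).compLeft (Fin s)))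

lemma mem_lat {g : Matrix (Fin s') (Fin s) Kser} {w : Fin s' → Kser} :
    w ∈ lat g ↔ ∃ u : Fin s → Rser, g.mulVec (fun j => toK (u j)) = w :=
  Iff.rfl

lemma col_mem_lat (g : Matrix (Fin s') (Fin s) Kser) (j : Fin s) : g.col j ∈ lat g := by
  refine mem_lat.mpr ⟨Pi.single j 1, ?_⟩
  have : (fun l => toK ((Pi.single j 1 : Fin s → Rser) l)) = Pi.single j 1 := by
    ext l
    by_cases h : l = j
    · subst h; simp
    · simp [h]
  rw [this, Matrix.mulVec_single_one]

lemma fg_lat (g : Matrix (Fin s') (Fin s) Kser) : (lat g).FG :=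
  Submodule.fg_range _

lemma isLattice_lat {g : Matrix (Fin s) (Fin s) Kser} (hg : IsUnit g) :
    Submodule.IsLattice Kser (lat g) where
  fg := fg_lat g
  span_eq_top := by
    rw [eq_top_iff]
    intro w _
    have hw : w = g.mulVec (g⁻¹.mulVec w) := by
      rw [Matrix.mulVec_mulVec, Matrix.mul_nonsing_inv _ ((Matrix.isUnit_iff_isUnit_det g).mp hg),
        Matrix.one_mulVec]
    rw [hw, Matrix.mulVec_eq_sum]
    refine Submodule.sum_mem _ fun j _ => ?_
    rw [op_smul_eq_smul]
    exact Submodule.smul_mem _ _ (Submodule.subset_span (col_mem_lat g j))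

variable {M : CMMod k n s} {M' : CMMod k n s'}
  {g : ZMod n → Matrix (Fin s) (Fin s) Kser} {g' : ZMod n → Matrix (Fin s') (Fin s') Kser}

lemma mulVec_toK (A : Matrix (Fin s') (Fin s) Rser) (u : Fin s → Rser) :
    (fun j => toK (A.mulVec u j)) = (A.map toK).mulVec (fun j => toK (u j)) := by
  ext j
  exact RingHom.map_mulVec toK A u j

lemma IsFrame.xe_smul_mem (h : IsFrame I M g) {i : ZMod n} {w : Fin s → Kser}
    (hw : w ∈ lat (g (i - 1))) : xe I i • w ∈ lat (g i) := by
  obtain ⟨u, rfl⟩ := mem_lat.mp hw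
  refine mem_lat.mpr ⟨(M.X i).mulVec u, ?_⟩
  rw [mulVec_toK, Matrix.mulVec_mulVec, h.mulX, Matrix.smul_mulVec, algebraMap_smul]

lemma IsFrame.ye_smul_mem (h : IsFrame I M g) {i : ZMod n} {w : Fin s → Kser}
    (hw : w ∈ lat (g i)) : ye I i • w ∈ lat (g (i - 1)) := by
  obtain ⟨u, rfl⟩ := mem_lat.mp hw
  refine mem_lat.mpr ⟨(M.Y i).mulVec u, ?_⟩
  rw [mulVec_toK, Matrix.mulVec_mulVec, h.mulY, Matrix.smul_mulVec, algebraMap_smul]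

/-- A linear map which preserves the lattices of the frames comes from a morphism. -/
lemma CMHom.exists_of_lat (h : IsFrame I M g) (h' : IsFrame I M' g')
    (L : (Fin s → Kser) →ₗ[Kser] (Fin s' → Kser))
    (hL : ∀ i, ∀ w ∈ lat (g i), L w ∈ lat (g' i)) :
    ∃ f : CMHom M M', ∀ i, g' i * (f.F i).map toK = LinearMap.toMatrix' L * g i := by
  choose u hu using fun i j => mem_lat.mp (hL i _ (col_mem_lat (g i) j))
  have hF : ∀ i, g' i * (Matrix.of fun a j => u i j a).map toK = LinearMap.toMatrix' L * g i := by
    intro i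
    ext a j
    have h1 := congrFun (hu i j) a
    rw [← LinearMap.toMatrix'_mulVec] at h1
    exact h1
  exact ⟨CMHom.ofConst h h' _ _ hF, hF⟩

end Lattices

section Components

variable {n : ℕ} [NeZero n] {I : Finset (ZMod n)} {V : Type*} [AddCommGroup V] [Module Rser V]
  [Module Kser V] [IsScalarTower Rser Kser V]

lemma exists_components (hn : 1 < n) (hI : I.card = 3) {U : ZMod n → Submodule Rser V}
    (hU : ∀ i, Submodule.IsLattice Kser (U i))
    (hX : ∀ i, ∀ w ∈ U (i - 1), xe I i • w ∈ U i) (hY : ∀ i, ∀ w ∈ U i, ye I i • w ∈ U (i - 1))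
    (φ : V →ₗ[Kser] Kser) (hφ : ∀ i, ∀ w ∈ U i, φ w ∈ toK.range)
    (hφ' : ∀ w, (∀ i, w ∈ U i) → ∃ r, φ w = toK (tser * r)) :
    ∃ ψ : ZMod 3 → V →ₗ[Kser] Kser, (∀ w, toK tser * ∑ l, ψ l w = 3 * φ w) ∧
      ∀ i, ∀ w ∈ U i, toK tser * ψ (cls I i) w ∈ toK.range ∧
        toK tser ^ 2 * ψ (cls I i + 1) w ∈ toK.range ∧
        (i + 1 ∈ I → ψ (cls I i + 1) w ∈ toK.range) ∧
        (i + 1 ∉ I → i + 2 ∈ I → toK tser * ψ (cls I i + 1) w ∈ toK.range) := by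
  obtain ⟨a, haI, hcls, ha⟩ := exists_peaks hn hI
  have hne : I.Nonempty := ⟨a 0, haI 0⟩
  have ht := toK_tser_ne_zero
  have hX₀ : ∀ i, i ∉ I → ∀ w ∈ U (i - 1), tser • w ∈ U i := fun i hi w hw => by
    simpa [xe, hi] using hX i w hw
  have hY₁ : ∀ i, i ∈ I → ∀ w ∈ U i, tser • w ∈ U (i - 1) := fun i hi w hw => by
    simpa [ye, hi] using hY i w hw
  have hY₀ : ∀ i, i ∉ I → U i ≤ U (i - 1) := fun i hi w hw => by
    simpa [ye, hi] using hY i w hw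
  have hle : ∀ i, U i ≤ U (a (cls I i)) := by
    refine cyclic_induction_back hne (fun i hi => by rw [ha i hi]) fun i hi h => ?_
    rw [cls_pred hn hI i, if_neg hi, add_zero]
    exact (hY₀ i hi).trans h
  have hcls_succ : ∀ i, cls I (i + 1) = cls I i + if i + 1 ∈ I then 1 else 0 := fun i => by
    rw [cls_pred hn hI (i + 1), add_sub_cancel_right]
  have hge : ∀ i, U (a (cls I i + 1) - 1) ≤ U i := by
    refine cyclic_induction_forward hne (fun i hi => ?_) fun i hi h => ?_
    · have := hcls_succ i
      rw [if_pos hi] at this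
      rw [← this, ha _ hi, add_sub_cancel_right]
    · rw [hcls_succ, if_neg hi, add_zero] at h
      have h' := hY₀ _ hi
      rw [add_sub_cancel_right] at h'
      exact h.trans h'
  have hpeak : ∀ l, ∀ w ∈ U (a l), tser • w ∈ U (a l - 1) := fun l => hY₁ _ (haI l)
  have hpred : ∀ l, cls I (a (l + 1) - 1) = l := fun l => by
    have h := cls_pred hn hI (a (l + 1))
    rw [if_pos (haI _), hcls] at h
    exact (add_right_cancel h).symm
  have hpeak2 : ∀ l m, m ≠ l → ∀ w ∈ U (a (l - 1)), tser ^ 2 • w ∈ U (a m - 1) := by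
    intro l m hlm w hw
    have hcase : ∀ l m : ZMod 3, m ≠ l → l - 1 = m ∨ l - 1 = m + 1 := by decide
    rw [pow_two, mul_smul]
    rcases hcase l m hlm with h | h
    · rw [h] at hw
      exact Submodule.smul_mem _ _ (hpeak m w hw)
    · rw [h] at hw
      have h1 := hle _ (hpeak _ w hw)
      rw [hpred] at h1
      exact hpeak m _ h1
  let B : ZMod 3 → Submodule Rser V := fun l =>
    U (a l - 1) ⊔ (U (a (l - 1))).map (LinearMap.lsmul Rser V (tser ^ 2))
  have hB : ∀ l, Submodule.IsLattice Kser (B l) := fun l =>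
    Submodule.IsLattice.of_le_of_isLattice_of_fg Kser le_sup_left
      ((hU _).fg.sup ((hU _).fg.map _))
  obtain ⟨ψ, hψ, hsum⟩ := exists_sum_of_integral_on_iInf B ((3 * (toK tser)⁻¹) • φ) (by
    intro w hw
    choose u hu z' hz' huz using fun l => Submodule.mem_sup.mp (hw l)
    choose z hz hzz using fun l => Submodule.mem_map.mp (hz' l)
    have hmem : ∀ m, w - ∑ l, tser ^ 2 • z l ∈ U (a m - 1) := by
      intro m
      rw [← Finset.add_sum_erase _ _ (Finset.mem_univ m), ← sub_sub]
      refine sub_mem ?_ (sum_mem fun l hl => hpeak2 l m (Finset.ne_of_mem_erase hl).symm _ (hz l))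
      rw [← huz m, ← hzz m]
      simpa using hu m
    obtain ⟨r, hr⟩ := hφ' _ fun i => hge i (hmem _)
    choose q hq using fun l => hφ _ _ (hz l)
    refine ⟨3 * (r + tser * ∑ l, q l), ?_⟩
    have h1 : φ w = toK tser * toK (r + tser * ∑ l, q l) := by
      have h2 : w = (w - ∑ l, tser ^ 2 • z l) + ∑ l, tser ^ 2 • z l := by abel
      rw [h2, map_add, hr, map_sum]
      have h3 : ∀ l, φ (tser ^ 2 • z l) = toK (tser ^ 2) * toK (q l) := fun l => by
        rw [hq, ← algebraMap_smul Kser (tser ^ 2) (z l), map_smul, smul_eq_mul]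
      simp only [h3, map_add, map_mul, map_pow, map_sum, ← Finset.mul_sum]
      ring
    rw [LinearMap.smul_apply, h1, smul_eq_mul, map_mul, map_ofNat]
    field_simp)
  have hψs : ∀ l r w, r • w ∈ B l → toK r * ψ l w ∈ toK.range := fun l r w hw => by
    have h := hψ l _ hw
    rwa [← algebraMap_smul Kser r w, map_smul, smul_eq_mul] at h
  refine ⟨ψ, fun w => ?_, fun i w hw => ⟨?_, ?_, fun h => ?_, fun h h' => ?_⟩⟩
  · have h := LinearMap.congr_fun hsum w
    rw [LinearMap.sum_apply, LinearMap.smul_apply, smul_eq_mul] at h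
    rw [h]
    field_simp
  · exact hψs _ _ _ (le_sup_left (a := U _) (hpeak _ _ (hle i hw)))
  · rw [← map_pow]
    refine hψs _ _ _ (le_sup_right (a := U _) (Submodule.mem_map.mpr ⟨w, ?_, rfl⟩))
    rw [add_sub_cancel_right]
    exact hle i hw
  · refine hψ _ _ (le_sup_left (a := U _) ?_)
    have h1 := hcls_succ i
    rw [if_pos h] at h1
    rw [← h1, ha _ h, add_sub_cancel_right]
    exact hw
  · refine hψs _ _ _ (le_sup_left (a := U _) ?_)
    have h1 := hcls_succ i
    have h2 := hcls_succ (i + 1)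
    rw [if_neg h, add_zero] at h1
    rw [add_assoc, one_add_one_eq_two, if_pos h', h1] at h2
    have h3 : i + 2 - 1 = i + 1 := by ring
    rw [← h2, ha _ h', h3]
    exact hX₀ _ h _ (by rwa [add_sub_cancel_right])

end Components

section Lifting

lemma cub_interpolate (p : ZMod 3 → Kser) (l : ZMod 3) :
    3 * p l = toK (cub l) * ∑ m, toK (cub m) ^ 2 * p m + ∑ m, p m +
      toK (cub l) ^ 2 * ∑ m, toK (cub m) * p m := by
  have hs : 1 + toK (cub 1) + toK (cub 1) ^ 2 = 0 := by
    rw [← map_one toK, ← map_pow, ← map_add, ← map_add, one_add_cub, map_zero]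
  have hsum : ∀ q : ZMod 3 → Kser, ∑ m, q m = q 0 + q 1 + q 2 := fun q => Fin.sum_univ_three q
  simp only [hsum, cub_two, cub_zero, map_pow, map_one]
  have hl : l = 0 ∨ l = 1 ∨ l = 2 := by revert l; decide
  set w := toK (cub 1)
  rcases hl with rfl | rfl | rfl
  · rw [cub_zero, map_one]
    linear_combination (-p 1 - (w ^ 2 - w + 1) * p 2) * hs
  · linear_combination (-p 0 - 2 * (w - 1) * p 1 - (w ^ 3 - w + 1) * p 2) * hs
  · rw [cub_two, map_pow]
    linear_combination (-p 0 * (w ^ 2 - w + 1) - p 1 * (w ^ 3 - w + 1)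
      - p 2 * 2 * (w - 1) * (w ^ 3 + 1)) * hs

lemma three_ne_zero_Kser : (3 : Kser) ≠ 0 := by
  have h := isUnit_three.map toK
  rw [map_ofNat] at h
  exact h.ne_zero

lemma mem_range_of_three_mul {x : Kser} (h : 3 * x ∈ toK.range) : x ∈ toK.range := by
  obtain ⟨r, hr⟩ := h
  obtain ⟨u, hu⟩ := isUnit_three
  refine ⟨(↑u⁻¹ : Rser) * r, mul_left_cancel₀ three_ne_zero_Kser ?_⟩
  rw [← hr, map_mul, ← mul_assoc, ← map_ofNat toK 3, ← map_mul]
  have : (OfNat.ofNat 3 : Rser) * (↑u⁻¹ : Rser) = 1 := by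
    rw [← u.mul_inv, hu]
  rw [this, map_one, one_mul]

lemma mem_lat_iff {s s' : ℕ} {g : Matrix (Fin s') (Fin s) Kser} {w : Fin s' → Kser} :
    w ∈ lat g ↔ ∃ u : Fin s → Kser, (∀ j, u j ∈ toK.range) ∧ g.mulVec u = w := by
  rw [mem_lat]
  constructor
  · rintro ⟨u, hu⟩
    exact ⟨_, fun j => ⟨u j, rfl⟩, hu⟩
  · rintro ⟨u, hu, h⟩
    choose v hv using hu
    exact ⟨v, by simpa only [hv] using h⟩

variable {n : ℕ} {I : Finset (ZMod n)}

/-- A criterion for membership in the lattices of the middle term. -/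
lemma mem_lat_midG {i : ZMod n} {y σ z : Kser} {ψ : ZMod 3 → Kser}
    (hσ : σ ∈ toK.range) (hsum : toK tser * ∑ l, ψ l = 3 * σ)
    (hy : 3 * y = ∑ l, toK (cub l) ^ 2 * (toK tser * ψ l))
    (hz : 3 * z = ∑ l, toK (cub l) * (toK tser * ψ l))
    (h0 : toK tser * ψ (cls I i) ∈ toK.range)
    (h1 : toK tser ^ 2 * ψ (cls I i + 1) ∈ toK.range)
    (h2 : i + 1 ∈ I → cls I (i + 1) = cls I i + 1 ∧ ψ (cls I i + 1) ∈ toK.range)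
    (h3 : i + 1 ∉ I → i + 2 ∈ I → toK tser * ψ (cls I i + 1) ∈ toK.range) :
    ![y, σ, z] ∈ lat (midG I i) := by
  have ht := toK_tser_ne_zero
  have hr : ∀ r, toK r ∈ toK.range := fun r => ⟨r, rfl⟩
  have h3r : (3 : Kser) ∈ toK.range := ⟨3, map_ofNat toK 3⟩
  have hp : ∀ l, toK tser * ψ l = toK (cub l) * y + σ + toK (cub l) ^ 2 * z := fun l => by
    refine mul_left_cancel₀ three_ne_zero_Kser ?_
    have h := cub_interpolate (fun m => toK tser * ψ m) l
    rw [h, ← hy, ← hz, ← Finset.mul_sum, hsum]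
    ring
  have hsum' : ∀ l, ψ (l - 1) = ∑ m, ψ m - ψ l - ψ (l + 1) := by
    have hq : ∀ q : ZMod 3 → Kser, ∑ m, q m = q 0 + q 1 + q 2 := fun q => Fin.sum_univ_three q
    intro l
    have hl : l = 0 ∨ l = 1 ∨ l = 2 := by revert l; decide
    rw [hq]
    rcases hl with rfl | rfl | rfl
    · rw [show (0 - 1 : ZMod 3) = 2 from rfl, zero_add]; ring
    · rw [show (1 - 1 : ZMod 3) = 0 from rfl, show (1 + 1 : ZMod 3) = 2 from rfl]; ring
    · rw [show (2 - 1 : ZMod 3) = 1 from rfl, show (2 + 1 : ZMod 3) = 0 from rfl]; ring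
  have hcases : ∀ l m : ZMod 3, m = l ∨ m = l + 1 ∨ m = l - 1 := by decide
  have hall : ∀ r, toK r * (toK tser * ψ (cls I i + 1)) ∈ toK.range →
      ∀ m, toK r * (toK tser * ψ m) ∈ toK.range := by
    intro r h m
    rcases hcases (cls I i) m with rfl | rfl | rfl
    · exact mul_mem (hr r) h0
    · exact h
    · have : toK r * (toK tser * ψ (cls I i - 1)) = toK r * (3 * σ) -
          toK r * (toK tser * ψ (cls I i)) - toK r * (toK tser * ψ (cls I i + 1)) := by
        rw [hsum', ← hsum]; ring
      rw [this]
      exact sub_mem (sub_mem (mul_mem (hr r) (mul_mem h3r hσ)) (mul_mem (hr r) h0)) h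
  have hyz : ∀ r, toK r * (toK tser * ψ (cls I i + 1)) ∈ toK.range →
      toK r * y ∈ toK.range ∧ toK r * z ∈ toK.range := by
    intro r h
    refine ⟨mem_range_of_three_mul ?_, mem_range_of_three_mul ?_⟩
    · rw [mul_left_comm, hy, Finset.mul_sum]
      refine sum_mem fun m _ => ?_
      rw [mul_left_comm, ← map_pow]
      exact mul_mem (hr _) (hall r h m)
    · rw [mul_left_comm, hz, Finset.mul_sum]
      refine sum_mem fun m _ => ?_
      rw [mul_left_comm]
      exact mul_mem (hr _) (hall r h m)
  have hyz1 : toK tser * ψ (cls I i + 1) ∈ toK.range → y ∈ toK.range ∧ z ∈ toK.range := by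
    have := hyz 1
    rwa [map_one, one_mul, one_mul, one_mul] at this
  have hcub : ∀ l, toK (cub l) ^ 3 = 1 := fun l => by rw [← map_pow, cub_pow_three, map_one]
  rw [mem_lat_iff, midG]
  split_ifs with hA hB
  · obtain ⟨hc, hψ⟩ := h2 hA
    obtain ⟨-, hz'⟩ := hyz1 (mul_mem (hr _) hψ)
    rw [hc]
    set c := toK (cub (cls I i + 1)) with hcdef
    refine ⟨![c ^ 2 * ψ (cls I i + 1), σ, z], fun j => ?_, ?_⟩
    · fin_cases j
      · exact mul_mem (pow_mem (hr _) 2) hψ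
      · exact hσ
      · exact hz'
    · have h := hp (cls I i + 1)
      have hc3 := hcub (cls I i + 1)
      rw [← hcdef] at h hc3
      ext j
      fin_cases j <;> simp [Matrix.mulVec, dotProduct, Fin.sum_univ_three]
      linear_combination c ^ 2 * h + (y + c * z) * hc3
  · obtain ⟨hy', hz'⟩ := hyz1 (h3 hA hB)
    refine ⟨![y, σ, z], fun j => ?_, Matrix.one_mulVec _⟩
    fin_cases j
    · exact hy'
    · exact hσ
    · exact hz'
  · obtain ⟨-, hz'⟩ := hyz tser (by rwa [← mul_assoc, ← pow_two])
    set c := toK (cub (cls I i)) with hcdef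
    refine ⟨![y + c * z, σ, toK tser * z], fun j => ?_, ?_⟩
    · fin_cases j
      · have h := hp (cls I i)
        have hc3 := hcub (cls I i)
        rw [← hcdef] at h hc3
        have : y + c * z = c ^ 2 * (toK tser * ψ (cls I i) - σ) := by
          linear_combination - c ^ 2 * h - (y + c * z) * hc3
        change y + c * z ∈ _
        rw [this]
        exact mul_mem (pow_mem (hr _) 2) (sub_mem h0 hσ)
      · exact hσ
      · exact hz'
    · ext j
      fin_cases j <;> simp [Matrix.mulVec, dotProduct, Fin.sum_univ_three, ht]
      rw [mul_assoc, inv_mul_cancel_left₀ ht]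
      ring

variable [NeZero n]

lemma isSplitEpi_of_unit {s : ℕ} (hI : I.card = 3) {M : CMMod 3 n s}
    {γ : ZMod n → Matrix (Fin s) (Fin s) Kser} (hγ : IsFrame I M γ) (f : CMHom M (rankOne I hI))
    {C : Matrix (Fin 1) (Fin s) Kser} (hC : ∀ i, (f.F i).map toK = C * γ i) {w : Fin s → Kser}
    (hw : ∀ i, w ∈ lat (γ i)) {r : Rser} (hr : C.mulVec w 0 = toK r) (hru : IsUnit r) :
    IsSplitEpi f := by
  obtain ⟨u, rfl⟩ := hru
  let L : (Fin 1 → Kser) →ₗ[Kser] (Fin s → Kser) :=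
    (LinearMap.toSpanSingleton Kser _ (toK (↑u⁻¹ : Rser) • w)).comp (LinearMap.proj 0)
  have hL : ∀ v, L v = v 0 • toK (↑u⁻¹ : Rser) • w := fun v => rfl
  obtain ⟨g, hg⟩ := CMHom.exists_of_lat (isFrame_rankOne I hI) hγ L (by
    intro i v hv
    obtain ⟨b, rfl⟩ := mem_lat.mp hv
    rw [hL, Matrix.one_mulVec, smul_smul, ← map_mul, algebraMap_smul]
    exact Submodule.smul_mem _ _ (hw i))
  refine ⟨g, fun i => map_toK_injective ?_⟩
  dsimp only
  rw [Matrix.map_mul, hC, Matrix.mul_assoc, hg, Matrix.mul_one]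
  ext a b
  rw [Subsingleton.elim a 0, Subsingleton.elim b 0]
  have h1 : (C * LinearMap.toMatrix' L) 0 0 = C.mulVec (L (Pi.single 0 1)) 0 := by
    rw [← LinearMap.toMatrix'_mulVec, Matrix.mulVec_mulVec, Matrix.mulVec_single_one]
    rfl
  rw [h1, hL, Pi.single_eq_same, one_smul, Matrix.mulVec_smul, Pi.smul_apply, hr, smul_eq_mul,
    ← map_mul, u.inv_mul]
  simp

variable (hn : 1 < n) (hI : I.card = 3) (hpeaks : ∀ i ∈ I, i + 1 ∉ I)

lemma exists_lift_midSeq (hn3 : 3 ≤ n) {s : ℕ} {M : CMMod 3 n s} (f : CMHom M (rankOne I hI))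
    (hf : ¬ IsSplitEpi f) :
    ∃ g : CMHom M (midMod hn hI hpeaks), ∀ i, (midSeq hn hI hpeaks).quo.F i * g.F i = f.F i := by
  obtain ⟨γ, hγ⟩ := exists_isFrame hn3 hI M
  obtain ⟨C, hC⟩ := f.exists_const hγ (isFrame_rankOne I hI)
  simp only [Matrix.one_mul] at hC
  let φ : (Fin s → Kser) →ₗ[Kser] Kser := (LinearMap.proj 0).comp C.mulVecLin
  have hφ : ∀ i, ∀ w ∈ lat (γ i), φ w ∈ toK.range := by
    intro i w hw
    obtain ⟨u, rfl⟩ := mem_lat.mp hw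
    refine ⟨(f.F i).mulVec u 0, ?_⟩
    have h := congrFun (mulVec_toK (f.F i) u) 0
    rw [hC, ← Matrix.mulVec_mulVec] at h
    exact h
  obtain ⟨ψ, hsum, hψ⟩ := exists_components hn hI (fun i => isLattice_lat (hγ.isUnit i))
    (fun i w hw => hγ.xe_smul_mem hw) (fun i w hw => hγ.ye_smul_mem hw) φ hφ (by
      intro w hw
      obtain ⟨r, hr⟩ := hφ 0 w (hw 0)
      have hru : ¬ IsUnit r := fun h => hf (isSplitEpi_of_unit hI hγ f hC hw hr.symm h)
      rw [PowerSeries.isUnit_iff_constantCoeff, isUnit_iff_ne_zero, not_not,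
        ← tser_dvd_iff] at hru
      obtain ⟨q, rfl⟩ := hru
      exact ⟨q, hr.symm⟩)
  let y : (Fin s → Kser) →ₗ[Kser] Kser :=
    (3 : Kser)⁻¹ • ∑ l, toK (cub l) ^ 2 • (toK tser • ψ l)
  let z : (Fin s → Kser) →ₗ[Kser] Kser := (3 : Kser)⁻¹ • ∑ l, toK (cub l) • (toK tser • ψ l)
  have h3 := three_ne_zero_Kser
  let L : (Fin s → Kser) →ₗ[Kser] (Fin 3 → Kser) := LinearMap.pi ![y, φ, z]
  have hLw : ∀ w, L w = ![y w, φ w, z w] := fun w => by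
    ext j
    fin_cases j <;> rfl
  obtain ⟨g, hg⟩ := CMHom.exists_of_lat hγ (isFrame_midMod hn hI hpeaks) L (by
    intro i w hw
    obtain ⟨h0, h1, h2, h4⟩ := hψ i w hw
    rw [hLw]
    refine mem_lat_midG (ψ := fun l => ψ l w) (hφ i w hw) (hsum w) ?_ ?_ h0 h1
      (fun h => ⟨?_, h2 h⟩) h4
    · simp only [y, LinearMap.smul_apply, LinearMap.sum_apply, smul_eq_mul,
        mul_inv_cancel_left₀ h3]
    · simp only [z, LinearMap.smul_apply, LinearMap.sum_apply, smul_eq_mul,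
        mul_inv_cancel_left₀ h3]
    · rw [cls_pred hn hI (i + 1), add_sub_cancel_right, if_pos h])
  refine ⟨g, fun i => map_toK_injective ?_⟩
  have hrow : ∀ b, (midG I i * (g.F i).map toK) 1 b = toK (g.F i 1 b) := fun b => by
    rw [midG]
    split_ifs <;> simp [Matrix.mul_apply, Fin.sum_univ_three]
  have hquo : (midSeq hn hI hpeaks).quo.F i = !![0, 1, 0] := rfl
  dsimp only
  rw [hC, hquo]
  ext a b
  rw [Subsingleton.elim a 0]
  have h1 := hrow b
  rw [hg] at h1
  have h2 : (LinearMap.toMatrix' L * γ i) 1 b = (C * γ i) 0 b := by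
    change (LinearMap.toMatrix' L).mulVec ((γ i).col b) 1 = φ ((γ i).col b)
    rw [LinearMap.toMatrix'_mulVec]
    rfl
  rw [← h2, h1, Matrix.map_apply, Matrix.mul_apply, Fin.sum_univ_three]
  simp

end Lifting

/-- Dual version: if `I` is a `3`-subset of `ℤ/n` with three peaks,
`X = I − 2` and `Y = I − 1`, then there is an almost split sequence
`0 → (L_X | L_Y) → M → L_I → 0` with `M` of rank 3; if `M` is indecomposable,
then `M = L_X | L_I | L_Y`. -/
theorem AR_sequence_three_peaks_dual (n : ℕ) (hn : 7 ≤ n)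
    (I : Finset (ZMod n)) (hI : I.card = 3) (hpeaks : ∀ i ∈ I, i + 1 ∉ I) :
    ∃ (A : CMMod 3 n 1) (M : CMMod 3 n 3) (N : CMMod 3 n 2),
      IsRankOne I A ∧
      HasFiltration N [I.image (· - 2), I.image (· - 1)] ∧
      ∃ S : CMses N M A, AlmostSplit S ∧
        (Indecomposable M → HasFiltration M [I.image (· - 2), I, I.image (· - 1)]) := by
  have : NeZero n := ⟨by omega⟩
  have hn1 : 1 < n := by omega
  exact ⟨rankOne I hI, midMod hn1 hI hpeaks, leftMod hn1 hI hpeaks, isRankOne_rankOne I hI,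
    hasFiltration_leftMod hn1 hI hpeaks, midSeq hn1 hI hpeaks,
    ⟨not_splits_midSeq hn1 hI hpeaks, indecomposable_leftMod hn1 hI hpeaks,
      indecomposable_rankOne hI,
      fun _ _ f hf => exists_lift_midSeq hn1 hI hpeaks (by omega) f hf⟩,
    fun _ => hasFiltration_midMod hn1 hI hpeaks⟩

end GCC
end
end
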